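/- arXiv:2301.00208 — 5 statements merged into one kernel-verified Lean document; each statement's English description precedes it below -/
import Mathlib

section
/- Let B be a unital complex Banach algebra and let A be a unital C*-algebra admitting a faithful tracial state. Let T : B → A be a surjective unital linear mapping which preserves invertible elements (i.e., T(x) is invertible in A whenever x is invertible in B). Then T is a Jordan homomorphism, i.e., T(a²) = (T a)² for every a ∈ B. -/
open scoped ComplexOrder


theorem aux_logseries {A : Type*} [NormedRing A] [NormedAlgebra ℂ A] [CompleteSpace A]
    (τ : A →L[ℂ] ℂ) (hτ : ∀ a b : A, τ (a * b) = τ (b * a))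
    (w w' : ℝ → A) (hw : ∀ t, HasDerivAt w (w' t) t) (hw' : Continuous w')
    (hlt : ∀ t ∈ Set.Icc (0:ℝ) 1, ‖w t‖ < 1)
    (hu : ∀ t, IsUnit (1 - w t))
    (K : ℝ → ℂ) (hK : ∀ t, HasDerivAt K (τ (Ring.inverse (1 - w t) * w' t)) t) :
    Filter.Tendsto (fun N : ℕ => ∑ n ∈ Finset.range N, τ (w 1 ^ (n+1)) / ((n:ℂ)+1)
      - ∑ n ∈ Finset.range N, τ (w 0 ^ (n+1)) / ((n:ℂ)+1)) Filter.atTop (nhds (K 1 - K 0)) := by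
  have hwc : Continuous w := continuous_iff_continuousAt.2 fun t => (hw t).continuousAt
  have hpow : ∀ (n : ℕ) t, HasDerivAt (fun s => τ (w s ^ (n+1)) / ((n:ℂ)+1)) (τ (w t ^ n * w' t)) t := by
    intro n t
    have h1 := (hw t).fun_pow' (n+1)
    have h2 := (τ.restrictScalars ℝ).hasFDerivAt.comp_hasDerivAt t h1
    have h3 := h2.div_const ((n:ℂ)+1)
    refine HasDerivAt.congr_deriv h3 ?_
    have hn : ((n:ℂ)+1) ≠ 0 := Nat.cast_add_one_ne_zero n
    rw [div_eq_iff hn]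
    simp only [ContinuousLinearMap.coe_restrictScalars', map_sum]
    rw [Finset.sum_congr rfl (g := fun _ => τ (w t ^ n * w' t))]
    · simp [mul_comm]
    · intro i hi
      have hi' : i ≤ n := by simpa [Nat.lt_succ_iff] using hi
      rw [hτ, ← mul_assoc, ← pow_add]
      congr 3
      simp; omega
  -- uniform bounds
  obtain ⟨t0, ht0, hq⟩ := isCompact_Icc.exists_isMaxOn (s := Set.Icc (0:ℝ) 1) (by simp)
    (hwc.norm.continuousOn)
  set q := ‖w t0‖ with hqdef
  have hq1 : q < 1 := hlt t0 ht0
  have hcont : Continuous fun t => Ring.inverse (1 - w t) * w' t := by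
    refine Continuous.mul (continuous_iff_continuousAt.2 fun t => ?_) hw'
    obtain ⟨u, hu'⟩ := hu t
    have := NormedRing.inverse_continuousAt u
    rw [hu'] at this
    exact ContinuousAt.comp (f := fun t => 1 - w t) this (by fun_prop)
  obtain ⟨C, hC⟩ := isCompact_Icc.exists_bound_of_continuousOn (s := Set.Icc (0:ℝ) 1) hcont.continuousOn
  have key : ∀ N : ℕ, ‖(∑ n ∈ Finset.range (N+1), τ (w 1 ^ (n+1)) / ((n:ℂ)+1)
      - ∑ n ∈ Finset.range (N+1), τ (w 0 ^ (n+1)) / ((n:ℂ)+1)) - (K 1 - K 0)‖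
        ≤ ‖τ‖ * (q ^ (N+1) * C) := by
    intro N
    have := norm_image_sub_le_of_norm_deriv_le_segment_01'
      (f := fun t => ∑ n ∈ Finset.range (N+1), τ (w t ^ (n+1)) / ((n:ℂ)+1) - K t)
      (f' := fun t => ∑ n ∈ Finset.range (N+1), τ (w t ^ n * w' t) - τ (Ring.inverse (1 - w t) * w' t))
      (C := ‖τ‖ * (q ^ (N+1) * C)) ?_ ?_
    · rw [sub_sub_sub_comm]; exact this
    · intro t _
      exact ((HasDerivAt.fun_sum fun n _ => hpow n t).sub (hK t)).hasDerivWithinAt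
    · intro t ht
      have ht' : t ∈ Set.Icc (0:ℝ) 1 := Set.Ico_subset_Icc_self ht
      have : ∑ n ∈ Finset.range (N+1), τ (w t ^ n * w' t) - τ (Ring.inverse (1 - w t) * w' t)
        = - τ (w t ^ (N+1) * (Ring.inverse (1 - w t) * w' t)) := by
        rw [← map_sum, ← map_sub, ← map_neg, ← Finset.sum_mul]
        congr 1
        have h1 : (∑ i ∈ Finset.range (N+1), w t ^ i) * (1 - w t) = 1 - w t ^ (N+1) :=
          geom_sum_mul_neg _ _
        have h2 : (∑ i ∈ Finset.range (N+1), w t ^ i) = (1 - w t ^ (N+1)) * Ring.inverse (1 - w t) := by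
          rw [← h1, mul_assoc, Ring.mul_inverse_cancel _ (hu t), mul_one]
        rw [h2]; noncomm_ring
      rw [this, norm_neg]
      refine (τ.le_opNorm _).trans ?_
      gcongr
      refine (norm_mul_le _ _).trans ?_
      gcongr
      · exact (norm_pow_le' _ (Nat.succ_pos N)).trans (pow_le_pow_left₀ (norm_nonneg _) (hq ht') _)
      · exact hC t ht'
  rw [← Filter.tendsto_add_atTop_iff_nat 1, tendsto_iff_norm_sub_tendsto_zero]
  refine squeeze_zero (fun _ => norm_nonneg _) key ?_
  have := (tendsto_pow_atTop_nhds_zero_of_lt_one (norm_nonneg _) hq1)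
  have := (((this.comp (Filter.tendsto_add_atTop_nat 1)).mul_const C).const_mul ‖τ‖)
  simpa using this

theorem aux_det {A : Type*} [CStarAlgebra A] [PartialOrder A] [StarOrderedRing A]
    (τ : A →L[ℂ] ℂ) (hτ1 : τ 1 = 1) (hτ : ∀ a b : A, τ (a * b) = τ (b * a))
    (hpos : ∀ a : A, 0 ≤ a → 0 ≤ τ a) (hstar : ∀ a : A, τ (star a) = star (τ a))
    (f f' : ℝ → A) (hf : ∀ t, HasDerivAt f (f' t) t) (hf' : Continuous f')
    (hu : ∀ t, IsUnit (f t)) (hf0 : f 0 = 1)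
    (H : ℝ → ℂ) (hH : ∀ t, HasDerivAt H (τ (Ring.inverse (f t) * f' t)) t) :
    (H 1).re - (H 0).re ≤ Real.log ‖f 1‖ := by
  have hnt : Nontrivial A := ⟨1, 0, fun h => by rw [h] at hτ1; simp at hτ1⟩
  have hfc : Continuous f := continuous_iff_continuousAt.2 fun t => (hf t).continuousAt
  have hgc : Continuous fun t => star (f t) * f t := by fun_prop
  obtain ⟨M, hM⟩ := isCompact_Icc.exists_bound_of_continuousOn (s := Set.Icc (0:ℝ) 1) hgc.continuousOn
  have hM1 : 1 ≤ M := by simpa [hf0] using hM 0 (by simp)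
  have hM0 : 0 < M := by linarith
  have hg1 : 0 < ‖star (f 1) * f 1‖ := norm_pos_iff.2 (((hu 1).star.mul (hu 1)).ne_zero)
  set w : ℝ → A := fun t => 1 - M⁻¹ • (star (f t) * f t) with hwdef
  set w' : ℝ → A := fun t => - (M⁻¹ • (star (f t) * f' t + star (f' t) * f t)) with hw'def
  have hw : ∀ t, HasDerivAt w (w' t) t := by
    intro t
    have := ((((hf t).star).mul (hf t)).const_smul M⁻¹).const_sub (1 : A)
    refine this.congr_deriv ?_
    simp only [hw'def]
    rw [add_comm]
  have h1w : ∀ t, 1 - w t = M⁻¹ • (star (f t) * f t) := fun t => by simp [hwdef]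
  have huw : ∀ t, IsUnit (1 - w t) := by
    intro t
    rw [h1w]
    have : IsUnit (algebraMap ℝ A M⁻¹) := (IsUnit.mk0 _ (by positivity)).map _
    rw [Algebra.smul_def]
    exact this.mul ((hu t).star.mul (hu t))
  have hwge : ∀ t (δ : ℝ), ‖star (f t) * f t‖ ≤ (1 - δ) * M → 0 ≤ w t - algebraMap ℝ A δ := by
    intro t δ h
    have h1 : star (f t) * f t ≤ algebraMap ℝ A ((1 - δ) * M) :=
      (IsSelfAdjoint.le_algebraMap_norm_self (.star_mul_self _)).trans
        (algebraMap_mono A h)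
    have h2 : M⁻¹ • (star (f t) * f t) ≤ M⁻¹ • algebraMap ℝ A ((1 - δ) * M) :=
      smul_le_smul_of_nonneg_left h1 (by positivity)
    have h3 : M⁻¹ • algebraMap ℝ A ((1 - δ) * M) = 1 - algebraMap ℝ A δ := by
      rw [Algebra.smul_def, ← map_mul, ← map_one (algebraMap ℝ A), ← map_sub]
      congr 1; field_simp
    rw [h3] at h2
    rw [hwdef]
    rw [sub_nonneg]
    exact le_sub_comm.1 h2
  have hw0 : ∀ t ∈ Set.Icc (0:ℝ) 1, 0 ≤ w t := by
    intro t ht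
    simpa using hwge t 0 (by simpa using hM t ht)
  have hlt : ∀ t ∈ Set.Icc (0:ℝ) 1, ‖w t‖ < 1 := by
    intro t ht
    have h0 := hw0 t ht
    have hle : ‖w t‖ ≤ 1 := by
      rw [CStarAlgebra.norm_le_iff_le_algebraMap (w t) zero_le_one h0, map_one]
      have : 0 ≤ M⁻¹ • (star (f t) * f t) := smul_nonneg (by positivity) (star_mul_self_nonneg _)
      rw [hwdef]; simpa using this
    refine lt_of_le_of_ne hle fun h => ?_
    have := CStarAlgebra.norm_mem_spectrum_of_nonneg h0
    rw [h, spectrum.mem_iff, map_one] at this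
    exact this (huw t)
  have hder : ∀ t, τ (Ring.inverse (1 - w t) * w' t) =
      -(τ (Ring.inverse (f t) * f' t) + star (τ (Ring.inverse (f t) * f' t))) := by
    intro t
    obtain ⟨u, hu'⟩ := hu t
    have hinv : Ring.inverse (1 - w t) = M • ((↑u⁻¹ : A) * star (↑u⁻¹ : A)) := by
      rw [h1w, ← hu']
      have hs : star (u : A) * star (↑u⁻¹ : A) = 1 := by rw [← star_mul]; simp
      have hY : (M⁻¹ • (star (u : A) * u)) * (M • ((↑u⁻¹ : A) * star (↑u⁻¹ : A))) = 1 := by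
        rw [smul_mul_smul_comm, inv_mul_cancel₀ hM0.ne', one_smul, mul_assoc,
          Units.mul_inv_cancel_left, hs]
      have hU : IsUnit (M⁻¹ • (star (u : A) * u)) := by
        have := huw t
        rwa [h1w, ← hu'] at this
      rw [← mul_one (Ring.inverse _), ← hY, Ring.inverse_mul_cancel_left _ _ hU]
    have hs2 : star (↑u⁻¹ : A) * star (u : A) = 1 := by rw [← star_mul]; simp
    rw [hinv, hw'def, ← hstar]
    simp only [← hu', Ring.inverse_unit, star_mul]
    rw [mul_neg, smul_mul_smul_comm, mul_inv_cancel₀ hM0.ne', one_smul, map_neg, mul_add, map_add,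
      mul_assoc, ← mul_assoc (star _) (star _), hs2, one_mul]
    congr 2
    rw [hτ, mul_assoc, Units.mul_inv_cancel_left]
  have hlim := aux_logseries τ hτ w w' hw (by fun_prop) hlt huw
    (fun t => -(H t + star (H t))) (fun t => by
      rw [hder]
      exact ((hH t).add (hH t).star).neg)
  have hlim2 := (Complex.continuous_re.tendsto _).comp hlim
  set δ : ℝ := 1 - ‖star (f 1) * f 1‖ / M with hδ
  have hδ0 : 0 ≤ δ := by
    rw [hδ, sub_nonneg, div_le_one hM0]; exact hM 1 (by simp)
  have hδ1 : δ < 1 := by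
    rw [hδ]; have := div_pos hg1 hM0; linarith
  have hwδ : 0 ≤ w 1 - algebraMap ℝ A δ := hwge 1 δ (le_of_eq (by rw [hδ]; field_simp; ring))
  have hwpow : ∀ n : ℕ, 0 ≤ w 1 ^ n - algebraMap ℝ A (δ ^ n) := by
    intro n
    induction n with
    | zero => simp
    | succ n ih =>
      have e : w 1 ^ (n+1) - algebraMap ℝ A (δ ^ (n+1)) =
          w 1 * (w 1 ^ n - algebraMap ℝ A (δ ^ n)) + δ ^ n • (w 1 - algebraMap ℝ A δ) := by
        rw [Algebra.smul_def, mul_sub, mul_sub, ← map_mul, pow_succ', pow_succ,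
          Algebra.commutes (δ ^ n) (w 1)]
        abel
      rw [e]
      refine add_nonneg (Commute.mul_nonneg (hw0 1 (by simp)) ih ?_)
        (smul_nonneg (by positivity) hwδ)
      exact ((Commute.refl _).pow_right n).sub_right (Algebra.commutes _ _).symm
  have hτalg : ∀ r : ℝ, τ (algebraMap ℝ A r) = r := by
    intro r
    rw [Algebra.algebraMap_eq_smul_one, ← Complex.coe_smul, map_smul, hτ1]; simp
  have hre : ∀ n : ℕ, δ ^ n ≤ (τ (w 1 ^ n)).re := by
    intro n
    have := hpos _ (hwpow n)
    rw [map_sub, hτalg] at this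
    have := (Complex.le_def.1 this).1
    simp only [Complex.zero_re, Complex.sub_re, Complex.ofReal_re] at this
    linarith
  have hdiv : ∀ (z : ℂ) (n : ℕ), (z / ((n:ℂ)+1)).re = z.re / ((n:ℝ)+1) := by
    intro z n
    have : ((n:ℂ)+1) = (((n:ℝ)+1 : ℝ) : ℂ) := by push_cast; rfl
    rw [this, Complex.div_ofReal_re]
  have hzero : ∀ n : ℕ, (τ (w 0 ^ n)).re = (1 - M⁻¹) ^ n := by
    intro n
    have : w 0 = algebraMap ℝ A (1 - M⁻¹) := by
      simp [hwdef, hf0, Algebra.algebraMap_eq_smul_one, sub_smul]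
    rw [this, ← map_pow, hτalg, Complex.ofReal_re]
  have hMi : 0 < M⁻¹ := by positivity
  have hMi1 : M⁻¹ ≤ 1 := inv_le_one_of_one_le₀ hM1
  have s1 := (Real.hasSum_pow_div_log_of_abs_lt_one (x := δ) (by rw [abs_of_nonneg hδ0]; exact hδ1)).tendsto_sum_nat
  have s2 := (Real.hasSum_pow_div_log_of_abs_lt_one (x := 1 - M⁻¹)
    (by rw [abs_of_nonneg (by linarith)]; linarith)).tendsto_sum_nat
  have hfin := le_of_tendsto_of_tendsto' (s1.sub s2) hlim2 (fun N => by
    simp only [Function.comp_apply, Complex.sub_re, Complex.re_sum, hdiv, hzero]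
    gcongr with n hn
    exact hre _)
  have e1 : 1 - δ = ‖f 1‖ * ‖f 1‖ / M := by rw [hδ, CStarRing.norm_star_mul_self]; ring
  have hf1 : ‖f 1‖ ≠ 0 := norm_ne_zero_iff.2 (hu 1).ne_zero
  rw [e1, Real.log_div (mul_ne_zero hf1 hf1) hM0.ne', Real.log_mul hf1 hf1, sub_sub_cancel,
    Real.log_inv] at hfin
  simp at hfin
  linarith

theorem aux_liouville (H : ℂ → ℂ) (hH : Differentiable ℂ H) (h0 : H 0 = 0) (C K : ℝ) (hC : 0 < C)
    (hK : 0 ≤ K) (hb : ∀ z, (H z).re ≤ C + K * ‖z‖) : deriv (deriv H) 0 = 0 := by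
  have key : ∀ R : ℝ, 0 < R → ‖deriv (deriv H) 0‖ ≤ 4 * (C + K * (2 * R)) / R ^ 2 := by
    intro R hR
    have hM : 0 < C + K * (2 * R) := by positivity
    have := Complex.norm_iteratedDeriv_le_of_forall_mem_sphere_norm_le (f := H) (c := 0) (R := R)
      (C := 2 * (C + K * (2 * R))) 2 hR hH.diffContOnCl ?_
    · rw [iteratedDeriv_succ, iteratedDeriv_one] at this
      refine this.trans (le_of_eq ?_)
      simp [Nat.factorial]; ring
    · intro z hz
      have hz : ‖z‖ = R := by simpa using hz
      have := Complex.borelCaratheodory_zero (f := H) (M := C + K * (2 * R)) (R := 2 * R) (z := z)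
        hM hH.differentiableOn ?_ (by positivity) (by simp [hz]; linarith) h0
      · rw [hz] at this
        refine this.trans (le_of_eq ?_)
        field_simp; ring
      · intro x hx
        have hx : ‖x‖ < 2 * R := by simpa using hx
        exact (hb x).trans (by gcongr)
  have hlim : Filter.Tendsto (fun R : ℝ => 4 * (C + K * (2 * R)) / R ^ 2) Filter.atTop (nhds 0) := by
    have h1 : Filter.Tendsto (fun R : ℝ => R⁻¹) Filter.atTop (nhds 0) := tendsto_inv_atTop_zero
    have h2 := ((h1.mul h1).const_mul (4 * C)).add (h1.const_mul (8 * K))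
    simp only [mul_zero, add_zero] at h2
    refine h2.congr' ?_
    filter_upwards [Filter.eventually_gt_atTop 0] with R hR
    field_simp; ring
  have := ge_of_tendsto hlim ((Filter.eventually_gt_atTop 0).mono key)
  exact norm_le_zero_iff.1 this

theorem aux_norm_exp {B : Type*} [NormedRing B] [NormedAlgebra ℂ B] [CompleteSpace B]
    (v : B) (C R : ℝ) (h : ∀ n : ℕ, ‖v ^ n‖ ≤ C * R ^ n) (s : ℂ) :
    ‖NormedSpace.exp (s • v)‖ ≤ C * Real.exp (‖s‖ * R) := by
  rw [NormedSpace.exp_eq_tsum ℂ]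
  have h1 : HasSum (fun n : ℕ => C * ((‖s‖ * R) ^ n / n.factorial)) (C * Real.exp (‖s‖ * R)) := by
    refine HasSum.mul_left _ ?_
    rw [Real.exp_eq_exp_ℝ]
    exact NormedSpace.expSeries_div_hasSum_exp (𝔸 := ℝ) _
  refine tsum_of_norm_bounded h1 fun n => ?_
  rw [smul_pow, norm_smul, norm_smul, norm_inv, norm_pow, Complex.norm_natCast]
  calc _ ≤ ((n.factorial : ℝ))⁻¹ * (‖s‖ ^ n * (C * R ^ n)) := by gcongr; exact h n
    _ = _ := by rw [mul_pow]; ring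

theorem aux_key {A B : Type*} [CStarAlgebra A] [PartialOrder A] [StarOrderedRing A]
    [NormedRing B] [NormedAlgebra ℂ B] [CompleteSpace B]
    (τ : A →L[ℂ] ℂ) (hτ1 : τ 1 = 1) (hτ : ∀ a b : A, τ (a * b) = τ (b * a))
    (hpos : ∀ a : A, 0 ≤ a → 0 ≤ τ a) (hstar : ∀ a : A, τ (star a) = star (τ a))
    (L : B →L[ℂ] A) (a : B) (hu : ∀ z : ℂ, IsUnit (L (NormedSpace.exp (z • a)))) :
    τ (Ring.inverse (L 1) * L (a * a)) = τ (Ring.inverse (L 1) * L a * (Ring.inverse (L 1) * L a)) := by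
  set f : ℂ → A := fun z => L (NormedSpace.exp (z • a)) with hf
  set f' : ℂ → A := fun z => L (NormedSpace.exp (z • a) * a) with hf'
  have hd : ∀ z, HasDerivAt f (f' z) z := fun z =>
    L.hasFDerivAt.comp_hasDerivAt z (hasDerivAt_exp_smul_const a z)
  have hd' : ∀ z, HasDerivAt f' (L (NormedSpace.exp (z • a) * a * a)) z := fun z =>
    L.hasFDerivAt.comp_hasDerivAt z ((hasDerivAt_exp_smul_const a z).mul_const a)
  have hinv : ∀ z, HasDerivAt (fun z => Ring.inverse (f z))
      (-(Ring.inverse (f z) * f' z * Ring.inverse (f z))) z := by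
    intro z
    obtain ⟨u, hu'⟩ := hu z
    have h1 := hasFDerivAt_ringInverse (𝕜 := ℂ) u
    rw [hu'] at h1
    have h2 := h1.comp_hasDerivAt z (hd z)
    refine h2.congr_deriv ?_
    simp only [hf] at *
    simp [← hu']
  have hh : ∀ z, HasDerivAt (fun z => τ (Ring.inverse (f z) * f' z))
      (τ (-(Ring.inverse (f z) * f' z * Ring.inverse (f z)) * f' z
        + Ring.inverse (f z) * L (NormedSpace.exp (z • a) * a * a))) z := fun z =>
    τ.hasFDerivAt.comp_hasDerivAt z ((hinv z).mul (hd' z))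
  obtain ⟨H, H0, hH⟩ := (Differentiable.isExactOn_univ
    (f := fun z => τ (Ring.inverse (f z) * f' z))
    (fun z => (hh z).differentiableAt)).with_val_at 0 0
  have hH : ∀ z, HasDerivAt H (τ (Ring.inverse (f z) * f' z)) z := fun z => hH z trivial
  have hf0 : f 0 = L 1 := by simp [hf]
  have hf'0 : f' 0 = L a := by simp [hf']
  have hbound : ∀ z, (H z).re ≤ Real.log ‖Ring.inverse (f 0) * f z‖ := by
    intro z
    have hline : ∀ t : ℝ, HasDerivAt (fun t : ℝ => (t : ℂ) * z) z t := fun t => by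
      simpa using (Complex.ofRealCLM.hasDerivAt (x := t)).mul_const z
    have hfc' : Continuous f' := continuous_iff_continuousAt.2 fun t => (hd' t).continuousAt
    have := aux_det τ hτ1 hτ hpos hstar
      (fun t : ℝ => Ring.inverse (f 0) * f (t * z))
      (fun t : ℝ => Ring.inverse (f 0) * (z • f' (t * z)))
      (fun t => ((hd (t * z)).scomp t (hline t)).const_mul _)
      (by fun_prop)
      (fun t => (hu 0).ringInverse.mul (hu _)) (by
        simpa only [Complex.ofReal_zero, zero_mul] using Ring.inverse_mul_cancel (f 0) (hu 0))
      (fun t => H (t * z)) (fun t => ?_)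
    · simpa [H0] using this
    · refine ((hH (t * z)).scomp t (hline t)).congr_deriv ?_
      obtain ⟨u, hu'⟩ := hu 0
      obtain ⟨v, hv'⟩ := hu (t * z)
      have e0 : f 0 = u := hu'.symm
      have e1 : f (t * z) = v := hv'.symm
      rw [e0, e1, ← map_smul]
      congr 1
      rw [Ring.inverse_unit, Ring.inverse_unit, ← Units.val_mul, Ring.inverse_unit, mul_inv_rev]
      simp [mul_assoc]
  have hpow : ∀ n : ℕ, ‖a ^ n‖ ≤ (‖(1:B)‖ + 1) * ‖a‖ ^ n := by
    intro n
    rcases Nat.eq_zero_or_pos n with rfl | hn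
    · simp
    · refine (norm_pow_le' a hn).trans ?_
      have : 0 ≤ ‖(1:B)‖ * ‖a‖ ^ n := by positivity
      linarith
  set D := ‖Ring.inverse (f 0)‖ * (‖L‖ * (‖(1:B)‖ + 1)) + 1 with hD
  have hD1 : 1 ≤ D := by have : 0 ≤ ‖Ring.inverse (f 0)‖ * (‖L‖ * (‖(1:B)‖ + 1)) := by positivity
                         linarith
  have hnt : Nontrivial A := ⟨1, 0, fun h => by rw [h] at hτ1; simp at hτ1⟩
  have hfin := aux_liouville H (fun z => (hH z).differentiableAt) H0 (Real.log D + 1) ‖a‖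
    (by have := Real.log_nonneg hD1; linarith) (norm_nonneg _) (fun z => by
      refine (hbound z).trans ?_
      have hp : 0 < ‖Ring.inverse (f 0) * f z‖ :=
        norm_pos_iff.2 ((hu 0).ringInverse.mul (hu z)).ne_zero
      have : ‖Ring.inverse (f 0) * f z‖ ≤ D * Real.exp (‖z‖ * ‖a‖) := by
        calc _ ≤ ‖Ring.inverse (f 0)‖ * (‖L‖ * ((‖(1:B)‖ + 1) * Real.exp (‖z‖ * ‖a‖))) := by
              refine (norm_mul_le _ _).trans ?_
              gcongr
              refine (L.le_opNorm _).trans ?_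
              gcongr
              exact aux_norm_exp a _ _ hpow z
          _ ≤ _ := by
              have := Real.exp_pos (‖z‖ * ‖a‖)
              rw [hD]; linarith
      have := Real.log_le_log hp this
      rw [Real.log_mul (by positivity) (Real.exp_pos _).ne', Real.log_exp] at this
      linarith)
  have hdH : deriv H = fun z => τ (Ring.inverse (f z) * f' z) := funext fun z => (hH z).deriv
  rw [hdH, (hh 0).deriv, hf0, hf'0] at hfin
  simp only [zero_smul, NormedSpace.exp_zero, one_mul, map_add, neg_mul, map_neg] at hfin
  rw [mul_assoc _ _ (L a)] at hfin
  linear_combination hfin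

theorem aux_gelfand {A : Type*} [NormedRing A] [NormedAlgebra ℂ A] [CompleteSpace A] (v : A)
    (R R' : ℝ) (hR : 0 ≤ R) (hRR : R < R') (h : ∀ k ∈ spectrum ℂ v, ‖k‖ ≤ R) :
    ∃ C : ℝ, 0 < C ∧ ∀ n : ℕ, ‖v ^ n‖ ≤ C * R' ^ n := by
  have hR' : 0 < R' := hR.trans_lt hRR
  have h1 : spectralRadius ℂ v < ENNReal.ofReal R' := by
    refine lt_of_le_of_lt (b := ENNReal.ofReal R) ?_ ((ENNReal.ofReal_lt_ofReal_iff hR').2 hRR)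
    refine iSup₂_le fun k hk => ?_
    rw [← enorm_eq_nnnorm, ← ofReal_norm]
    exact ENNReal.ofReal_le_ofReal (h k hk)
  have h2 := (spectrum.pow_norm_pow_one_div_tendsto_nhds_spectralRadius v).eventually_lt_const h1
  obtain ⟨N, hN⟩ := Filter.eventually_atTop.1 h2
  refine ⟨1 + ∑ n ∈ Finset.range (N+1), ‖v ^ n‖ / R' ^ n, by positivity, fun n => ?_⟩
  rcases lt_or_ge n (N+1) with hn | hn
  · rw [← div_le_iff₀ (by positivity)]
    have := Finset.single_le_sum (f := fun n => ‖v ^ n‖ / R' ^ n) (fun i _ => by positivity)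
      (Finset.mem_range.2 hn)
    linarith
  · have h3 := hN n (by omega)
    rw [ENNReal.ofReal_lt_ofReal_iff hR'] at h3
    have hn0 : (n:ℝ) ≠ 0 := by norm_cast; omega
    have h4 := pow_le_pow_left₀ (by positivity) h3.le n
    rw [← Real.rpow_natCast, ← Real.rpow_mul (norm_nonneg _), one_div, inv_mul_cancel₀ hn0,
      Real.rpow_one] at h4
    refine h4.trans (le_mul_of_one_le_left (by positivity) ?_)
    have : 0 ≤ ∑ n ∈ Finset.range (N+1), ‖v ^ n‖ / R' ^ n := by positivity
    linarith

theorem aux_trace_le {A : Type*} [CStarAlgebra A] [PartialOrder A] [StarOrderedRing A]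
    (τ : A →L[ℂ] ℂ) (hτ1 : τ 1 = 1) (hτ : ∀ a b : A, τ (a * b) = τ (b * a))
    (hpos : ∀ a : A, 0 ≤ a → 0 ≤ τ a) (hstar : ∀ a : A, τ (star a) = star (τ a))
    (v : A) (R : ℝ) (hR : 0 ≤ R) (h : ∀ k ∈ spectrum ℂ v, ‖k‖ ≤ R) : (τ v).re ≤ R := by
  refine le_of_forall_gt_imp_ge_of_dense fun R' hRR => ?_
  have hnt : Nontrivial A := ⟨1, 0, fun h => by rw [h] at hτ1; simp at hτ1⟩
  obtain ⟨C, hC, hn⟩ := aux_gelfand v R R' hR hRR h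
  have huE : ∀ x : A, IsUnit (NormedSpace.exp x) := fun x => by
    have := NormedSpace.invertibleExpOfMemBall (𝕂 := ℂ) (x := x)
      ((NormedSpace.expSeries_radius_eq_top ℂ A).symm ▸ edist_lt_top _ _)
    exact isUnit_of_invertible _
  have key : ∀ s : ℝ, 0 < s → (τ v).re ≤ Real.log C * s⁻¹ + R' := by
    intro s hs
    have hd : ∀ t : ℝ, HasDerivAt (fun t : ℝ => NormedSpace.exp (t • ((s:ℂ) • v)))
      (NormedSpace.exp (t • ((s:ℂ) • v)) * ((s:ℂ) • v)) t := fun t =>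
        hasDerivAt_exp_smul_const (𝕂 := ℝ) ((s:ℂ) • v) t
    have := aux_det τ hτ1 hτ hpos hstar (fun t : ℝ => NormedSpace.exp (t • ((s:ℂ) • v)))
      (fun t : ℝ => NormedSpace.exp (t • ((s:ℂ) • v)) * ((s:ℂ) • v)) hd
      ((continuous_iff_continuousAt.2 fun t => (hd t).continuousAt).mul continuous_const)
      (fun t => huE _) (by simp) (fun t => t • τ ((s:ℂ) • v)) (fun t => by
        rw [Ring.inverse_mul_cancel_left _ _ (huE _)]
        simpa using (hasDerivAt_id t).smul_const (τ ((s:ℂ) • v)))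
    simp only [one_smul, zero_smul, map_smul, smul_eq_mul, Complex.re_ofReal_mul, Complex.zero_re, sub_zero] at this
    have hb := aux_norm_exp v C R' hn s
    have hl := Real.log_le_log (norm_pos_iff.2 (huE _).ne_zero) hb
    rw [Real.log_mul hC.ne' (Real.exp_pos _).ne', Real.log_exp, Complex.norm_real, Real.norm_of_nonneg hs.le] at hl
    have : s * (τ v).re ≤ s * (Real.log C * s⁻¹ + R') := by
      calc _ ≤ _ := this.trans hl
        _ = _ := by field_simp
    exact le_of_mul_le_mul_left this hs
  have hl : Filter.Tendsto (fun s : ℝ => Real.log C * s⁻¹ + R') Filter.atTop (nhds (Real.log C * 0 + R')) :=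
    (tendsto_inv_atTop_zero.const_mul _).add_const _
  have := ge_of_tendsto hl ((Filter.eventually_gt_atTop 0).mono key)
  simpa using this

theorem aux_exp_unit {A : Type*} [NormedRing A] [NormedAlgebra ℂ A] [CompleteSpace A] (x : A) :
    IsUnit (NormedSpace.exp x) := by
  have := NormedSpace.invertibleExpOfMemBall (𝕂 := ℂ) (x := x)
      ((NormedSpace.expSeries_radius_eq_top ℂ A).symm ▸ edist_lt_top _ _)
  exact isUnit_of_invertible _

theorem aux_real (x K : ℝ) (h : ∀ s : ℝ, s ^ 2 * x ≤ K) : x ≤ 0 := by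
  by_contra hx
  push Not at hx
  have h1 := h (|K| / x + 1)
  have h2 : (1:ℝ) ≤ |K| / x + 1 := by have : 0 ≤ |K| / x := by positivity
                                      linarith
  have h3 : (|K| / x + 1) * x ≤ (|K| / x + 1) ^ 2 * x := by
    gcongr; nlinarith
  have h4 : (|K| / x + 1) * x = |K| + x := by field_simp
  have := le_abs_self K
  linarith

theorem aux_quad (α β γ : ℂ) (K : ℝ) (h : ∀ z : ℂ, (α + 2 * z * β + z ^ 2 * γ).re ≤ K) : β = 0 := by
  have h2 : ∀ z : ℂ, (z ^ 2 * γ).re ≤ K - α.re := by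
    intro z
    have h1 := h z
    have h2 := h (-z)
    have e : (-z) ^ 2 = z ^ 2 := by ring
    rw [e, mul_neg, neg_mul] at h2
    simp only [Complex.add_re, Complex.neg_re] at h1 h2
    linarith
  have hg : ∀ w : ℂ, (w ^ 2 * γ).re ≤ 0 := fun w => aux_real _ (K - α.re) fun s => by
    have := h2 (s * w)
    rw [mul_pow, mul_assoc, ← Complex.ofReal_pow, Complex.re_ofReal_mul] at this
    exact this
  have hγ : γ = 0 := by
    have a1 := hg 1
    have a2 := hg Complex.I
    have a3 := hg (1 + Complex.I)
    have a4 := hg (1 - Complex.I)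
    have e3 : (1 + Complex.I) ^ 2 = 2 * Complex.I := by linear_combination Complex.I_sq
    have e4 : (1 - Complex.I) ^ 2 = - (2 * Complex.I) := by linear_combination Complex.I_sq
    rw [e3] at a3
    rw [e4] at a4
    simp at a1 a2 a3 a4
    apply Complex.ext <;> simp <;> linarith
  subst hγ
  have hb : ∀ s : ℝ, s * (2 * Complex.normSq β) ≤ K - α.re := by
    intro s
    have := h (s * (starRingEnd ℂ) β)
    rw [mul_zero, add_zero, mul_assoc, mul_assoc, mul_comm ((starRingEnd ℂ) β), Complex.mul_conj,
      Complex.add_re] at this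
    have e : (2 * ((s:ℂ) * (Complex.normSq β : ℂ))) = ((2 * (s * Complex.normSq β) : ℝ) : ℂ) := by
      push_cast; rfl
    rw [e, Complex.ofReal_re] at this
    linarith
  have := aux_real _ _ (fun s => hb (s ^ 2))
  have h0 := Complex.normSq_nonneg β
  exact Complex.normSq_eq_zero.1 (by linarith)

theorem aux_cont {A B : Type*} [CStarAlgebra A] [PartialOrder A] [StarOrderedRing A]
    [NormedRing B] [NormedAlgebra ℂ B] [CompleteSpace B]
    (τ : A →L[ℂ] ℂ) (hτ1 : τ 1 = 1) (hτ : ∀ a b : A, τ (a * b) = τ (b * a))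
    (hpos : ∀ a : A, 0 ≤ a → 0 ≤ τ a) (hstar : ∀ a : A, τ (star a) = star (τ a))
    (hfaith : ∀ a : A, τ (star a * a) = 0 → a = 0)
    (T : B →ₗ[ℂ] A) (hTsurj : Function.Surjective T) (hT1 : T 1 = 1)
    (hTinv : ∀ x : B, IsUnit x → IsUnit (T x)) : Continuous T := by
  have hsp : ∀ x : B, (τ (T x * T x)).re ≤ (‖x‖ * ‖(1:B)‖) ^ 2 := by
    intro x
    refine aux_trace_le τ hτ1 hτ hpos hstar _ _ (by positivity) fun k hk => ?_
    rw [← sq, spectrum.map_pow_of_pos (T x) two_pos] at hk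
    obtain ⟨j, hj, rfl⟩ := hk
    have hj' : j ∈ spectrum ℂ x := by
      rw [spectrum.mem_iff] at hj ⊢
      refine fun hu => hj ?_
      have := hTinv _ hu
      rwa [map_sub, Algebra.algebraMap_eq_smul_one, map_smul, hT1,
        ← Algebra.algebraMap_eq_smul_one] at this
    simp only [norm_pow]
    gcongr
    exact spectrum.norm_le_norm_mul_of_mem hj'
  refine T.continuous_of_seq_closed_graph fun u x y hu hTu => ?_
  have h0 : Filter.Tendsto (fun n => u n - x) Filter.atTop (nhds 0) := by
    simpa using hu.sub_const x
  have hT0 : Filter.Tendsto (fun n => T (u n - x)) Filter.atTop (nhds (y - T x)) := by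
    simpa using hTu.sub_const (T x)
  set e := y - T x with he
  have hzero : ∀ c : A, τ (c * e) = 0 := by
    intro c
    obtain ⟨b, rfl⟩ := hTsurj c
    refine aux_quad (τ (T b * T b)) _ (τ (e * e)) ((‖b‖ * ‖(1:B)‖) ^ 2) fun z => ?_
    have l1 : Filter.Tendsto (fun n => (τ (T (b + z • (u n - x)) * T (b + z • (u n - x)))).re)
        Filter.atTop (nhds (τ ((T b + z • e) * (T b + z • e))).re) := by
      have : Filter.Tendsto (fun n => T (b + z • (u n - x))) Filter.atTop (nhds (T b + z • e)) := by
        simp only [map_add, map_smul]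
        exact (hT0.const_smul z).const_add _
      exact (Complex.continuous_re.tendsto _).comp ((τ.continuous.tendsto _).comp (this.mul this))
    have l2 : Filter.Tendsto (fun n => (‖b + z • (u n - x)‖ * ‖(1:B)‖) ^ 2)
        Filter.atTop (nhds ((‖b + z • (0:B)‖ * ‖(1:B)‖) ^ 2)) :=
      ((((h0.const_smul z).const_add b).norm).mul_const _).pow 2
    have := le_of_tendsto_of_tendsto' l1 l2 fun n => hsp _
    rw [smul_zero, add_zero] at this
    refine le_trans (le_of_eq ?_) this
    congr 1
    simp only [add_mul, mul_add, smul_mul_assoc, mul_smul_comm, map_add, map_smul, smul_eq_mul,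
      hτ e (T b)]
    ring
  have := hfaith e (hzero _)
  exact sub_eq_zero.1 this

theorem aux_diff {A : Type*} [NormedRing A] [NormedAlgebra ℂ A] [CompleteSpace A]
    (τ : A →L[ℂ] ℂ) (hτ : ∀ a b : A, τ (a * b) = τ (b * a))
    (p q r : ℂ → A) (p' q' r' : A) (hp : HasDerivAt p p' 0) (hq : HasDerivAt q q' 0)
    (hr : HasDerivAt r r' 0) (hp0 : p 0 = 1)
    (h : ∀ z, τ (Ring.inverse (p z) * r z) =
      τ (Ring.inverse (p z) * q z * (Ring.inverse (p z) * q z))) :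
    τ r' - τ (p' * r 0) = 2 * τ (q' * q 0) - 2 * τ (p' * q 0 * q 0) := by
  have hinv : HasDerivAt (fun z => Ring.inverse (p z)) (-p') 0 := by
    have h1 := hasFDerivAt_ringInverse (𝕜 := ℂ) (1 : Aˣ)
    rw [Units.val_one, ← hp0] at h1
    refine (h1.comp_hasDerivAt 0 hp).congr_deriv ?_
    simp
  have hi0 : Ring.inverse (p 0) = 1 := by rw [hp0, Ring.inverse_one]
  have d1 := τ.hasFDerivAt.comp_hasDerivAt 0 (hinv.mul hr)
  have d2 := τ.hasFDerivAt.comp_hasDerivAt 0 ((hinv.mul hq).mul (hinv.mul hq))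
  have e : (τ ∘ ((fun z => Ring.inverse (p z)) * r)) = (τ ∘ ((fun z => Ring.inverse (p z)) * q * ((fun z => Ring.inverse (p z)) * q))) :=
    funext h
  have d1' : HasDerivAt (τ ∘ ((fun z => Ring.inverse (p z)) * r)) _ 0 := d1
  rw [e] at d1'
  have := d1'.unique d2
  simp only [hi0, one_mul, map_add, neg_mul, map_neg, add_mul, mul_add, mul_neg, Pi.mul_apply] at this
  have c1 := hτ (q 0) (p' * q 0)
  have c2 := hτ (q 0) q'
  linear_combination this - c1 + c2

theorem aux_final {A B : Type*} [CStarAlgebra A] [PartialOrder A] [StarOrderedRing A]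
    [NormedRing B] [NormedAlgebra ℂ B] [CompleteSpace B]
    (τ : A →L[ℂ] ℂ) (hτ1 : τ 1 = 1) (hτ : ∀ a b : A, τ (a * b) = τ (b * a))
    (hpos : ∀ a : A, 0 ≤ a → 0 ≤ τ a) (hstar : ∀ a : A, τ (star a) = star (τ a))
    (hfaith : ∀ a : A, τ (star a * a) = 0 → a = 0)
    (T : B →L[ℂ] A) (hTsurj : Function.Surjective T) (hT1 : T 1 = 1)
    (hTinv : ∀ x : B, IsUnit x → IsUnit (T x)) (a : B) : T (a * a) = T a * T a := by
  have hI : ∀ a, τ (T (a * a)) = τ (T a * T a) := by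
    intro a
    have := aux_key τ hτ1 hτ hpos hstar T a (fun z => hTinv _ (aux_exp_unit _))
    simpa [hT1] using this
  have hIp : ∀ a b, τ (T (a * b)) + τ (T (b * a)) = 2 * τ (T a * T b) := by
    intro a b
    have h := hI (a + b)
    simp only [mul_add, add_mul, map_add] at h
    have := hτ (T b) (T a)
    linear_combination h - hI a - hI b + this
  have hexp : ∀ b : B, HasDerivAt (fun z : ℂ => NormedSpace.exp (z • b)) b 0 := by
    intro b
    simpa using hasDerivAt_exp_smul_const b (0:ℂ)
  have hIIl : ∀ a b, τ (T (b * (a * a))) - τ (T b * T (a * a)) =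
      2 * τ (T (b * a) * T a) - 2 * τ (T b * T a * T a) := by
    intro a b
    have := aux_diff τ hτ (fun z => T (NormedSpace.exp (z • b)))
      (fun z => T (NormedSpace.exp (z • b) * a)) (fun z => T (NormedSpace.exp (z • b) * (a * a)))
      (T b) (T (b * a)) (T (b * (a * a)))
      (T.hasFDerivAt.comp_hasDerivAt 0 (hexp b))
      (T.hasFDerivAt.comp_hasDerivAt 0 ((hexp b).mul_const a))
      (T.hasFDerivAt.comp_hasDerivAt 0 ((hexp b).mul_const (a * a)))
      (by simp [hT1]) (fun z => ?_)
    · simpa using this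
    · have := aux_key τ hτ1 hτ hpos hstar
        (T.comp (ContinuousLinearMap.mul ℂ B (NormedSpace.exp (z • b)))) a
        (fun y => hTinv _ ((aux_exp_unit _).mul (aux_exp_unit _)))
      simpa using this
  have hIIr : ∀ a b, τ (T (a * a * b)) - τ (T b * T (a * a)) =
      2 * τ (T (a * b) * T a) - 2 * τ (T b * T a * T a) := by
    intro a b
    have := aux_diff τ hτ (fun z => T (NormedSpace.exp (z • b)))
      (fun z => T (a * NormedSpace.exp (z • b))) (fun z => T (a * a * NormedSpace.exp (z • b)))
      (T b) (T (a * b)) (T (a * a * b))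
      (T.hasFDerivAt.comp_hasDerivAt 0 (hexp b))
      (T.hasFDerivAt.comp_hasDerivAt 0 ((hexp b).const_mul a))
      (T.hasFDerivAt.comp_hasDerivAt 0 ((hexp b).const_mul (a * a)))
      (by simp [hT1]) (fun z => ?_)
    · simpa using this
    · have := aux_key τ hτ1 hτ hpos hstar
        (T.comp ((ContinuousLinearMap.mul ℂ B).flip (NormedSpace.exp (z • b)))) a
        (fun y => hTinv _ ((aux_exp_unit _).mul (aux_exp_unit _)))
      simpa using this
  have hF : ∀ a, τ (T (a * a) * T a) = τ (T a * T a * T a) := by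
    intro a
    have h1 := hIIl a a
    have h2 := hIp a (a * a)
    have h3 := hτ (T a) (T (a * a))
    rw [mul_assoc a a a] at h2
    linear_combination (-(1:ℂ)/2) * h1 + (1/4) * h2 + 0 * h3
  have hG : ∀ a b, τ (T (a * b) * T a) + τ (T (b * a) * T a) + τ (T (a * a) * T b)
      = 3 * τ (T a * T a * T b) := by
    intro a b
    have f1 := hF (a + b)
    have f2 := hF (a - b)
    have f3 := hF b
    simp only [map_add, map_sub, mul_add, add_mul, mul_sub, sub_mul] at f1 f2
    have c1 := hτ (T b) (T a * T a)
    have c2 := hτ (T b * T a) (T a)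
    have c3 := hτ (T a) (T b * T a)
    simp only [← mul_assoc] at c1 c2 c3
    linear_combination (f1 - f2) / 2 - f3 + 2 * c1 - c2
  have hfin : ∀ b, τ ((T (a * a) - T a * T a) * T b) = 0 := by
    intro b
    rw [sub_mul, map_sub]
    have g := hG a b
    have l := hIIl a b
    have r := hIIr a b
    have p := hIp b (a * a)
    have c1 := hτ (T b) (T a * T a)
    simp only [← mul_assoc] at c1 l r p
    linear_combination g + (l + r - p) / 2 - 2 * c1
  obtain ⟨b, hb⟩ := hTsurj (star (T (a * a) - T a * T a))
  have h := hfin b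
  rw [hb, hτ] at h
  exact sub_eq_zero.1 (hfaith _ h)

open scoped ComplexOrder

/-- **Mathieu–Schulz.** Every surjective unital linear map from a unital complex Banach
algebra onto a unital C*-algebra carrying a faithful tracial state which preserves
invertible elements is a Jordan homomorphism. -/
theorem jordan_of_invertibility_preserving
    {B A : Type*} [NormedRing B] [NormedAlgebra ℂ B] [CompleteSpace B]
    [CStarAlgebra A]
    (τ : A →ₗ[ℂ] ℂ)
    (hτ1 : τ 1 = 1)
    (hτtrace : ∀ a b : A, τ (a * b) = τ (b * a))
    (hτpos : ∀ a : A, 0 ≤ τ (star a * a))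
    (hτfaithful : ∀ a : A, τ (star a * a) = 0 → a = 0)
    (T : B →ₗ[ℂ] A)
    (hTsurj : Function.Surjective T)
    (hT1 : T 1 = 1)
    (hTinv : ∀ x : B, IsUnit x → IsUnit (T x)) :
    ∀ a : B, T (a * a) = T a * T a := by
  let _ := CStarAlgebra.spectralOrder A
  have _ := CStarAlgebra.spectralOrderedRing A
  have hpos : ∀ a : A, 0 ≤ a → 0 ≤ τ a := by
    intro a ha
    obtain ⟨b, rfl⟩ := CStarAlgebra.nonneg_iff_eq_star_mul_self.1 ha
    exact hτpos b
  let P : A →ₚ[ℂ] ℂ := PositiveLinearMap.mk₀ τ hpos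
  have hcont : Continuous τ := map_continuous P
  have hstar : ∀ a : A, τ (star a) = star (τ a) := fun a => map_star P a
  let τ' : A →L[ℂ] ℂ := ⟨τ, hcont⟩
  have hT : Continuous T :=
    aux_cont τ' hτ1 hτtrace hpos hstar hτfaithful T hTsurj hT1 hTinv
  exact aux_final τ' hτ1 hτtrace hpos hstar hτfaithful ⟨T, hT⟩ hTsurj hT1 hTinv
end

section
/- Let B be a unital complex Banach algebra and let A be a unital C*-algebra admitting a faithful family of tracial states, i.e., a family {τ_i : i ∈ I} of tracial states such that τ_i(a* a) = 0 for all i ∈ I implies a = 0. Let T : B → A be a surjective unital linear mapping which preserves invertible elements. Then T is a Jordan homomorphism, i.e., T(a²) = (T a)² for every a ∈ B. -/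
open scoped ComplexOrder
open Set Filter Topology

section pathlemmas
variable {A : Type*} [CStarAlgebra A] [PartialOrder A] [StarOrderedRing A]

lemma JT.pow_lower {b : A} {β : ℝ} (hβ : 0 ≤ β) (hb : 0 ≤ b) (h : algebraMap ℝ A β ≤ b) (k : ℕ) :
    algebraMap ℝ A (β ^ k) ≤ b ^ k := by
  have hsa : IsSelfAdjoint b := IsSelfAdjoint.of_nonneg hb
  rw [← cfc_pow_id (R := ℝ) b k]
  refine algebraMap_le_cfc _ _ _ (fun x hx => ?_)
  have := (algebraMap_le_iff_le_spectrum (R := ℝ) (r := β) (a := b)).1 h x hx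
  gcongr

lemma JT.norm_one_sub_lt [Nontrivial A] {g : A} (hg : 0 ≤ g) (hn : ‖g‖ ≤ 1) (hu : IsUnit g) :
    ‖1 - g‖ < 1 := by
  have h1 : g ≤ 1 := (CStarAlgebra.norm_le_one_iff_of_nonneg g).1 hn
  have h2 : 0 ≤ 1 - g := sub_nonneg.2 h1
  have h3 : ‖1 - g‖ ≤ 1 := (CStarAlgebra.norm_le_one_iff_of_nonneg (1 - g)).2 (by simpa using hg)
  refine lt_of_le_of_ne h3 (fun h => ?_)
  have h4 := CStarAlgebra.norm_mem_spectrum_of_nonneg (a := 1 - g) h2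
  rw [h, spectrum.mem_iff] at h4
  apply h4
  simpa using hu

set_option linter.unusedSectionVars false in
lemma JT.hasDerivAt_trace_pow (τ : A →L[ℂ] ℂ) (htr : ∀ a b, τ (a * b) = τ (b * a))
    {b : ℝ → A} {b' : A} {t : ℝ} (hb : HasDerivAt b b' t) (k : ℕ) :
    HasDerivAt (fun t => τ (b t ^ (k + 1)) / (k + 1)) (τ (b t ^ k * b')) t := by
  have h := (τ.restrictScalars ℝ).hasFDerivAt.comp_hasDerivAt t (hb.fun_pow' (k + 1))
  have h2 := h.div_const ((k : ℂ) + 1)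
  convert! h2 using 1
  have hk : (k : ℂ) + 1 ≠ 0 := by exact_mod_cast Nat.succ_ne_zero k
  rw [eq_div_iff hk]
  simp only [ContinuousLinearMap.coe_restrictScalars', map_sum]
  rw [Finset.sum_congr rfl (g := fun _ => τ (b t ^ k * b'))]
  · simp [mul_comm]
  · intro i hi
    have : i ≤ k := by simpa [Nat.lt_succ_iff] using hi
    rw [htr, ← mul_assoc, ← pow_add]
    congr 4
    simp; omega

lemma JT.path_core (τ : A →L[ℂ] ℂ) (htr : ∀ a b, τ (a * b) = τ (b * a))
    (hpos : ∀ a, 0 ≤ a → 0 ≤ τ a) (h1 : τ 1 = 1)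
    (hstar : ∀ a, τ (star a) = star (τ a))
    (F F' : ℝ → A) (ψ : ℝ → ℝ)
    (hF : ∀ t ∈ Icc (0 : ℝ) 1, HasDerivAt F (F' t) t)
    (hF' : ContinuousOn F' (Icc 0 1))
    (hu : ∀ t ∈ Icc (0 : ℝ) 1, IsUnit (F t)) (hF0 : F 0 = 1)
    (hψ : ∀ t ∈ Icc (0 : ℝ) 1, HasDerivAt ψ (τ (Ring.inverse (F t) * F' t)).re t)
    (hψ0 : ψ 0 = 0) : ψ 1 ≤ Real.log ‖F 1‖ := by
  have : Nontrivial A := ⟨1, 0, fun h => by simp [h] at h1⟩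
  have hFc : ContinuousOn F (Icc 0 1) := fun t ht => (hF t ht).continuousAt.continuousWithinAt
  set G : ℝ → A := fun t => star (F t) * F t with hG
  set G' : ℝ → A := fun t => star (F' t) * F t + star (F t) * F' t with hG'
  have hGd : ∀ t ∈ Icc (0 : ℝ) 1, HasDerivAt G (G' t) t := fun t ht =>
    (hF t ht).star.mul (hF t ht)
  have hGc : ContinuousOn G (Icc 0 1) := hFc.star.mul hFc
  have hG'c : ContinuousOn G' (Icc 0 1) := (hF'.star.mul hFc).add (hFc.star.mul hF')
  have hGu : ∀ t ∈ Icc (0 : ℝ) 1, IsUnit (G t) := fun t ht => ((hu t ht).star).mul (hu t ht)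
  have hGpos : ∀ t, 0 ≤ G t := fun t => star_mul_self_nonneg _
  have hIc : ContinuousOn (fun t => Ring.inverse (G t)) (Icc 0 1) := fun t ht => by
    obtain ⟨u, hu⟩ := hGu t ht
    have := NormedRing.inverse_continuousAt u
    rw [hu] at this
    exact this.comp_continuousWithinAt (hGc t ht)
  have hlog : ∀ t ∈ Icc (0 : ℝ) 1, τ (Ring.inverse (G t) * G' t) =
      ((2 * (τ (Ring.inverse (F t) * F' t)).re : ℝ) : ℂ) := by
    intro t ht
    obtain ⟨u, hu⟩ := hu t ht
    have e1 : Ring.inverse (G t) = ↑u⁻¹ * star (↑u⁻¹ : A) := by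
      have : G t = ↑(star u * u) := by simp [hG, hu]
      rw [this, Ring.inverse_unit]; simp
    have e2 : star (↑u⁻¹ : A) * star (u : A) = 1 := by rw [← star_mul]; simp
    have e3 : τ (Ring.inverse (G t) * G' t) =
        star (τ (↑u⁻¹ * F' t)) + τ (↑u⁻¹ * F' t) := by
      rw [← hstar, e1, hG']
      simp only [← hu, mul_add, map_add]
      congr 1
      · rw [htr, mul_assoc, ← mul_assoc (u : A)]
        simp
      · congr 1
        rw [mul_assoc, ← mul_assoc (star (↑u⁻¹ : A)), e2, one_mul]
    rw [e3, ← hu, Ring.inverse_unit]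
    apply Complex.ext <;> simp; ring
  obtain ⟨M0, hM0⟩ := isCompact_Icc.exists_bound_of_continuousOn hGc
  have h0mem : (0 : ℝ) ∈ Icc (0 : ℝ) 1 := by simp
  have h1mem : (1 : ℝ) ∈ Icc (0 : ℝ) 1 := by simp
  have hM0' : 1 ≤ M0 := by simpa [hG, hF0] using hM0 0 h0mem
  set c : ℝ := M0⁻¹ with hc
  have hcpos : 0 < c := by positivity
  have hc1 : c ≤ 1 := inv_le_one_of_one_le₀ hM0'
  have hcG : ∀ t ∈ Icc (0 : ℝ) 1, c * ‖G t‖ ≤ 1 := fun t ht => by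
    rw [hc, inv_mul_le_one₀ (by positivity)]; exact hM0 t ht
  set b : ℝ → A := fun t => 1 - c • G t with hb
  have hbc : ContinuousOn b (Icc 0 1) := continuousOn_const.sub (hGc.const_smul c)
  have hbd : ∀ t ∈ Icc (0 : ℝ) 1, HasDerivAt b (-(c • G' t)) t := fun t ht =>
    ((hGd t ht).const_smul c).const_sub 1
  have hcGn : ∀ t, 0 ≤ c • G t := fun t => smul_nonneg hcpos.le (hGpos t)
  have hblt : ∀ t ∈ Icc (0 : ℝ) 1, ‖b t‖ < 1 := fun t ht => by
    apply JT.norm_one_sub_lt (hcGn t)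
    · rw [norm_smul, Real.norm_of_nonneg hcpos.le]; exact hcG t ht
    · have := (hGu t ht).smul (Units.mk0 c hcpos.ne')
      simpa [Units.smul_def] using this
  obtain ⟨t0, ht0, hq⟩ := isCompact_Icc.exists_isMaxOn ⟨0, h0mem⟩ hbc.norm
  set q := ‖b t0‖ with hqdef
  have hq1 : q < 1 := hblt t0 ht0
  have hq0 : 0 ≤ q := norm_nonneg _
  obtain ⟨K, hK⟩ := isCompact_Icc.exists_bound_of_continuousOn (hIc.mul hG'c)
  have key : ∀ N : ℕ, 2 * ψ 1 ≤ ∑ k ∈ Finset.range N, (1 - c) ^ (k + 1) / ((k : ℝ) + 1)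
      - ∑ k ∈ Finset.range N, (1 - c * ‖G 1‖) ^ (k + 1) / ((k : ℝ) + 1) + ‖τ‖ * (q ^ N * K) := by
    intro N
    set S : ℝ → ℂ := fun t => ∑ k ∈ Finset.range N, τ (b t ^ (k + 1)) / (k + 1) with hS
    have hSd : ∀ t ∈ Icc (0 : ℝ) 1, HasDerivAt (fun t => S t + ((2 * ψ t : ℝ) : ℂ))
        (τ (b t ^ N * (Ring.inverse (G t) * G' t))) t := by
      intro t ht
      have d1 : HasDerivAt S (∑ k ∈ Finset.range N, τ (b t ^ k * (-(c • G' t)))) t :=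
        HasDerivAt.fun_sum fun k _ => JT.hasDerivAt_trace_pow τ htr (hbd t ht) k
      have d2 := (((hψ t ht).const_mul 2).ofReal_comp)
      have d3 := d1.add d2
      convert! d3 using 1
      rw [← hlog t ht, ← map_sum, ← map_add, ← Finset.sum_mul]
      congr 1
      have e := geom_sum_mul_neg (b t) N
      have e' : (1 : A) - b t = c • G t := by simp [hb]
      rw [e'] at e
      have e2 : (∑ i ∈ Finset.range N, b t ^ i) * (c • G' t)
          = (1 - b t ^ N) * (Ring.inverse (G t) * G' t) := by
        rw [← e]
        simp only [mul_smul_comm, smul_mul_assoc]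
        rw [mul_assoc, ← mul_assoc (G t), Ring.mul_inverse_cancel _ (hGu t ht), one_mul]
      rw [mul_neg, e2]
      noncomm_ring
    have mv := norm_image_sub_le_of_norm_deriv_le_segment_01' (C := ‖τ‖ * (q ^ N * K))
      (fun t ht => (hSd t ht).hasDerivWithinAt) (fun t ht => by
        have ht' := Ico_subset_Icc_self ht
        refine (τ.le_opNorm _).trans ?_
        gcongr
        refine (norm_mul_le _ _).trans ?_
        gcongr
        · exact (norm_pow_le _ _).trans (by gcongr; exact hq ht')
        · exact hK t ht')
    have re := (Complex.re_le_norm _).trans mv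
    have s0 : (S 0).re = ∑ k ∈ Finset.range N, (1 - c) ^ (k + 1) / ((k : ℝ) + 1) := by
      have : b 0 = algebraMap ℂ A ((1 - c : ℝ) : ℂ) := by
        simp [hb, hG, hF0, Algebra.algebraMap_eq_smul_one, sub_smul]
      have : S 0 = ((∑ k ∈ Finset.range N, (1 - c) ^ (k + 1) / ((k : ℝ) + 1) : ℝ) : ℂ) := by
        simp only [hS, this, Algebra.algebraMap_eq_smul_one, smul_pow, one_pow, map_smul, h1]
        simp
      rw [this, Complex.ofReal_re]
    have s1 : ∑ k ∈ Finset.range N, (1 - c * ‖G 1‖) ^ (k + 1) / ((k : ℝ) + 1) ≤ (S 1).re := by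
      simp only [hS, Complex.re_sum]
      refine Finset.sum_le_sum fun k _ => ?_
      have e : ((k : ℂ) + 1) = (((k : ℝ) + 1 : ℝ) : ℂ) := by push_cast; rfl
      rw [e, Complex.div_ofReal_re]
      gcongr
      have hb1 : 0 ≤ b 1 := by
        rw [hb, sub_nonneg]
        refine (CStarAlgebra.norm_le_one_iff_of_nonneg _ (hcGn 1)).1 ?_
        rw [norm_smul, Real.norm_of_nonneg hcpos.le]; exact hcG 1 h1mem
      have hb2 : algebraMap ℝ A (1 - c * ‖G 1‖) ≤ b 1 := by
        have : G 1 ≤ algebraMap ℝ A ‖G 1‖ :=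
          IsSelfAdjoint.le_algebraMap_norm_self (IsSelfAdjoint.of_nonneg (hGpos 1))
        have := smul_le_smul_of_nonneg_left this hcpos.le
        simp only [hb, map_sub, map_one, map_mul]
        rw [Algebra.smul_def c (algebraMap ℝ A _)] at this
        gcongr
      have := JT.pow_lower (sub_nonneg.2 (hcG 1 h1mem)) hb1 hb2 (k + 1)
      have := hpos _ (sub_nonneg.2 this)
      rw [map_sub, IsScalarTower.algebraMap_apply ℝ ℂ A, Algebra.algebraMap_eq_smul_one (A := A),
        map_smul, h1] at this
      have := (Complex.le_def.1 this).1
      have e5 : algebraMap ℝ ℂ ((1 - c * ‖G 1‖) ^ (k + 1))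
          = (((1 - c * ‖G 1‖) ^ (k + 1) : ℝ) : ℂ) := rfl
      rw [e5] at this
      simpa only [Complex.sub_re, smul_eq_mul, mul_one, Complex.ofReal_re, Complex.zero_re,
        sub_nonneg] using this
    simp [hψ0] at re
    rw [← s0]
    linarith
  have hg : 0 < ‖G 1‖ := norm_pos_iff.2 (hGu 1 h1mem).ne_zero
  have lim1 := (Real.hasSum_pow_div_log_of_abs_lt_one (x := 1 - c)
    (by rw [abs_lt]; constructor <;> linarith)).tendsto_sum_nat
  have lim2 := (Real.hasSum_pow_div_log_of_abs_lt_one (x := 1 - c * ‖G 1‖)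
    (by have := hcG 1 h1mem; have : 0 < c * ‖G 1‖ := by positivity
        rw [abs_lt]; constructor <;> linarith)).tendsto_sum_nat
  have lim3 := ((tendsto_pow_atTop_nhds_zero_of_lt_one hq0 hq1).mul_const K).const_mul ‖τ‖
  have := ge_of_tendsto' ((lim1.sub lim2).add lim3) key
  rw [sub_sub_cancel, sub_sub_cancel, Real.log_mul hcpos.ne' hg.ne'] at this
  have e : ‖G 1‖ = ‖F 1‖ ^ 2 := by
    simp only [hG]; rw [CStarRing.norm_star_mul_self, sq]
  rw [e, Real.log_pow] at this
  push_cast at this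
  linarith

lemma JT.path_pow (τ : A →L[ℂ] ℂ) (htr : ∀ a b, τ (a * b) = τ (b * a))
    (hpos : ∀ a, 0 ≤ a → 0 ≤ τ a) (h1 : τ 1 = 1)
    (hstar : ∀ a, τ (star a) = star (τ a)) (j : ℕ) :
    ∀ (F F' : ℝ → A) (ψ : ℝ → ℝ),
    (∀ t ∈ Icc (0 : ℝ) 1, HasDerivAt F (F' t) t) →
    (ContinuousOn F' (Icc 0 1)) →
    (∀ t ∈ Icc (0 : ℝ) 1, IsUnit (F t)) → (F 0 = 1) →
    (∀ t ∈ Icc (0 : ℝ) 1, HasDerivAt ψ (τ (Ring.inverse (F t) * F' t)).re t) →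
    (ψ 0 = 0) → 2 ^ j * ψ 1 ≤ Real.log ‖F 1 ^ (2 ^ j)‖ := by
  induction j with
  | zero =>
    intro F F' ψ hF hF' hu hF0 hψ hψ0
    simpa using JT.path_core τ htr hpos h1 hstar F F' ψ hF hF' hu hF0 hψ hψ0
  | succ j ih =>
    intro F F' ψ hF hF' hu hF0 hψ hψ0
    have hFc : ContinuousOn F (Icc 0 1) := fun t ht => (hF t ht).continuousAt.continuousWithinAt
    have := ih (fun t => F t * F t) (fun t => F' t * F t + F t * F' t) (fun t => 2 * ψ t)
      (fun t ht => (hF t ht).mul (hF t ht)) ((hF'.mul hFc).add (hFc.mul hF'))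
      (fun t ht => (hu t ht).mul (hu t ht)) (by simp [hF0])
      (fun t ht => by
        convert! (hψ t ht).const_mul 2 using 1
        obtain ⟨u, hu⟩ := hu t ht
        rw [← hu, ← Units.val_mul, Ring.inverse_unit, Ring.inverse_unit, mul_add, map_add,
          mul_inv_rev, Units.val_mul]
        have e1 : τ (↑u⁻¹ * ↑u⁻¹ * (F' t * ↑u)) = τ (↑u⁻¹ * F' t) := by
          rw [htr]
          simp only [mul_assoc, Units.mul_inv_cancel_left]
          exact htr _ _
        have e2 : τ (↑u⁻¹ * ↑u⁻¹ * (↑u * F' t)) = τ (↑u⁻¹ * F' t) := by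
          simp only [mul_assoc, Units.inv_mul_cancel_left]
        rw [e1, e2, ← two_mul]
        simp) (by simp [hψ0])
    have e : (F 1 * F 1) ^ 2 ^ j = F 1 ^ 2 ^ (j + 1) := by rw [← sq, ← pow_mul, pow_succ']
    simp only [e] at this
    rw [pow_succ]
    linarith

lemma JT.path_spec (τ : A →L[ℂ] ℂ) (htr : ∀ a b, τ (a * b) = τ (b * a))
    (hpos : ∀ a, 0 ≤ a → 0 ≤ τ a) (h1 : τ 1 = 1)
    (hstar : ∀ a, τ (star a) = star (τ a))
    (F F' : ℝ → A) (ψ : ℝ → ℝ)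
    (hF : ∀ t ∈ Icc (0 : ℝ) 1, HasDerivAt F (F' t) t)
    (hF' : ContinuousOn F' (Icc 0 1))
    (hu : ∀ t ∈ Icc (0 : ℝ) 1, IsUnit (F t)) (hF0 : F 0 = 1)
    (hψ : ∀ t ∈ Icc (0 : ℝ) 1, HasDerivAt ψ (τ (Ring.inverse (F t) * F' t)).re t)
    (hψ0 : ψ 0 = 0) {M : ℝ} (hM : spectralRadius ℂ (F 1) ≤ ENNReal.ofReal (Real.exp M)) :
    ψ 1 ≤ M := by
  have : Nontrivial A := ⟨1, 0, fun h => by simp [h] at h1⟩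
  have lim := (spectrum.pow_norm_pow_one_div_tendsto_nhds_spectralRadius (F 1)).comp
    (tendsto_pow_atTop_atTop_of_one_lt (one_lt_two (α := ℕ)))
  have : ENNReal.ofReal (Real.exp (ψ 1)) ≤ spectralRadius ℂ (F 1) := by
    refine ge_of_tendsto' lim fun j => ?_
    apply ENNReal.ofReal_le_ofReal
    have k := JT.path_pow τ htr hpos h1 hstar j F F' ψ hF hF' hu hF0 hψ hψ0
    have p : 0 < ‖F 1 ^ (2 ^ j)‖ := norm_pos_iff.2 ((hu 1 (by simp)).pow _).ne_zero
    rw [Real.rpow_def_of_pos p]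
    apply Real.exp_le_exp.2
    push_cast
    rw [mul_one_div, le_div_iff₀ (by positivity)]
    linarith
  have := this.trans hM
  rw [ENNReal.ofReal_le_ofReal_iff (Real.exp_pos _).le] at this
  exact Real.exp_le_exp.1 this

lemma JT.complex_core (τ : A →L[ℂ] ℂ) (htr : ∀ a b, τ (a * b) = τ (b * a))
    (hpos : ∀ a, 0 ≤ a → 0 ≤ τ a) (h1 : τ 1 = 1)
    (hstar : ∀ a, τ (star a) = star (τ a))
    (F F1 F2 F3 : ℂ → A)
    (hF : ∀ z, HasDerivAt F (F1 z) z) (hF1 : ∀ z, HasDerivAt F1 (F2 z) z)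
    (hF2 : ∀ z, HasDerivAt F2 (F3 z) z) (hF0 : F 0 = 1) {R M : ℝ} (hR : 0 < R) (hM : 0 < M)
    (hu : ∀ z ∈ Metric.ball (0 : ℂ) R, IsUnit (F z))
    (hs : ∀ z ∈ Metric.ball (0 : ℂ) R,
      spectralRadius ℂ (F z) ≤ ENNReal.ofReal (Real.exp M)) :
    ‖τ (F2 0) - τ (F1 0 * F1 0)‖ ≤ 2 * (2 * M) / (R / 2) ^ 2 ∧
    ‖τ (F3 0) - 3 * τ (F1 0 * F2 0) + 2 * τ (F1 0 * F1 0 * F1 0)‖ ≤ 6 * (2 * M) / (R / 2) ^ 3 := by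
  set I : ℂ → A := fun z => Ring.inverse (F z) with hI
  set h : ℂ → ℂ := fun z => τ (I z * F1 z) with hh
  set k : ℂ → ℂ := fun z => τ (I z * F2 z - I z * F1 z * I z * F1 z) with hk
  have hId : ∀ z ∈ Metric.ball (0 : ℂ) R, HasDerivAt I (-(I z * F1 z * I z)) z := by
    intro z hz
    obtain ⟨u, hu⟩ := hu z hz
    have := hasFDerivAt_ringInverse (𝕜 := ℂ) u
    rw [hu] at this
    have := this.comp_hasDerivAt z (hF z)
    convert! this using 1
    simp [hI, ← hu]
  have hhd : ∀ z ∈ Metric.ball (0 : ℂ) R, HasDerivAt h (k z) z := by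
    intro z hz
    have := τ.hasFDerivAt.comp_hasDerivAt z ((hId z hz).mul (hF1 z))
    convert! this using 1
    simp only [hk]
    congr 1
    noncomm_ring
  have h0 : (0 : ℂ) ∈ Metric.ball (0 : ℂ) R := by simpa using hR
  have hI0 : I 0 = 1 := by simp [hI, hF0]
  have hkd : HasDerivAt k (τ (F3 0) - 3 * τ (F1 0 * F2 0) + 2 * τ (F1 0 * F1 0 * F1 0)) 0 := by
    have dI := hId 0 h0
    have := τ.hasFDerivAt.comp_hasDerivAt 0 ((dI.mul (hF2 0)).sub
      (((dI.mul (hF1 0)).mul dI).mul (hF1 0)))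
    convert! this using 1
    simp only [hI0, one_mul, mul_one, map_add, map_sub, map_neg, neg_mul, mul_neg, add_mul,
      Pi.mul_apply]
    rw [htr (F2 0) (F1 0)]
    ring
  obtain ⟨φ, hφ0, hφ⟩ := (DifferentiableOn.isExactOn_ball (f := h) (c := 0) (r := R)
    (fun z hz => (hhd z hz).differentiableAt.differentiableWithinAt)).with_val_at 0 0
  have hφd : DifferentiableOn ℂ φ (Metric.ball 0 R) :=
    fun z hz => (hφ z hz).differentiableAt.differentiableWithinAt
  have hre : Set.MapsTo φ (Metric.ball 0 R) {z | z.re ≤ M} := by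
    intro z hz
    have hmem : ∀ t ∈ Icc (0 : ℝ) 1, (t : ℂ) * z ∈ Metric.ball (0 : ℂ) R := by
      intro t ht
      simp only [mem_ball_zero_iff, norm_mul, Complex.norm_real, Real.norm_of_nonneg ht.1] at hz ⊢
      exact (mul_le_of_le_one_left (norm_nonneg _) ht.2).trans_lt hz
    have hline : ∀ t : ℝ, HasDerivAt (fun t : ℝ => (t : ℂ) * z) z t := fun t => by
      simpa using (Complex.ofRealCLM.hasDerivAt (x := t)).mul_const z
    have := JT.path_spec τ htr hpos h1 hstar (fun t => F ((t : ℂ) * z))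
      (fun t => z • F1 ((t : ℂ) * z)) (fun t => (φ ((t : ℂ) * z)).re)
      (fun t ht => (hF _).scomp t (hline t))
      (Continuous.continuousOn (by
        have : Continuous F1 := continuous_iff_continuousAt.2 fun z => (hF1 z).continuousAt
        fun_prop))
      (fun t ht => hu _ (hmem t ht)) (by simp [hF0])
      (fun t ht => by
        have d := (hφ _ (hmem t ht)).scomp t (hline t)
        have d2 := Complex.reCLM.hasFDerivAt.comp_hasDerivAt t d
        convert! d2 using 1
        simp [hh, hI])
      (by simp [hφ0]) (M := M) (by simpa using hs z hz)
    simpa using this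
  have hb : ∀ z ∈ Metric.sphere (0 : ℂ) (R / 2), ‖φ z‖ ≤ 2 * M := by
    intro z hz
    have hz' : ‖z‖ = R / 2 := by simpa using hz
    have := Complex.borelCaratheodory_zero hM hφd hre hR (z := z) (by simp [hz']; linarith) hφ0
    rw [hz'] at this
    convert this using 1
    field_simp
    ring
  have hdc : DiffContOnCl ℂ φ (Metric.ball 0 (R / 2)) := by
    apply DifferentiableOn.diffContOnCl
    rw [closure_ball _ (by positivity)]
    exact hφd.mono (Metric.closedBall_subset_ball (by linarith))
  have nb : Metric.ball (0 : ℂ) R ∈ 𝓝 (0 : ℂ) := Metric.ball_mem_nhds _ hR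
  have ev1 : deriv φ =ᶠ[𝓝 0] h := by
    filter_upwards [nb] with z hz using (hφ z hz).deriv
  have ev2 : deriv (deriv φ) =ᶠ[𝓝 0] k := by
    refine ev1.deriv.trans ?_
    filter_upwards [nb] with z hz using (hhd z hz).deriv
  have c2 := Complex.norm_iteratedDeriv_le_of_forall_mem_sphere_norm_le 2 (half_pos hR) hdc hb
  have c3 := Complex.norm_iteratedDeriv_le_of_forall_mem_sphere_norm_le 3 (half_pos hR) hdc hb
  have i2 : iteratedDeriv 2 φ = deriv (deriv φ) := by
    rw [iteratedDeriv_succ, iteratedDeriv_one]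
  have i3 : iteratedDeriv 3 φ = deriv (deriv (deriv φ)) := by
    rw [iteratedDeriv_succ, i2]
  rw [i2, ev2.eq_of_nhds] at c2
  rw [i3, ev2.deriv_eq, hkd.deriv] at c3
  constructor
  · simpa [hk, hI0] using c2
  · simpa [Nat.factorial] using c3
end pathlemmas

section alg
open Polynomial

lemma JT.coeff_pow {B : Type*} [Ring B] (x : B) (n : ℕ) :
    ∀ k, ((1 + C x * X : B[X]) ^ n).coeff k = (n.choose k : B) * x ^ k := by
  induction n with
  | zero => intro k; cases k <;> simp [coeff_one]
  | succ n ih =>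
    intro k
    rw [pow_succ, mul_add, mul_one, coeff_add, ← mul_assoc]
    cases k with
    | zero => simp [ih]
    | succ k =>
      rw [coeff_mul_X, coeff_mul_C, ih, ih, Nat.choose_succ_succ, mul_assoc, ← pow_succ]
      push_cast
      noncomm_ring

lemma JT.choose_three (n : ℕ) : 6 * (n.choose 3 : ℂ) = n * (n - 1) * (n - 2) := by
  induction n with
  | zero => simp
  | succ n ih =>
    rw [Nat.choose_succ_succ, Nat.cast_add, mul_add, ih, Nat.cast_choose_two]
    push_cast
    ring

lemma JT.lim_one {α : ℂ} {K : ℝ} (h : ∀ n : ℕ, 1 ≤ n → n * ‖α‖ ≤ K) : α = 0 := by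
  by_contra hα
  have hp : 0 < ‖α‖ := norm_pos_iff.2 hα
  obtain ⟨n, hn⟩ := exists_nat_gt (K / ‖α‖)
  have := h (n + 1) (by simp)
  rw [div_lt_iff₀ hp] at hn
  push_cast at this
  linarith

lemma JT.lim_two {α β : ℂ} {K : ℝ}
    (h : ∀ n : ℕ, 1 ≤ n → ‖(n : ℂ) ^ 2 * α + n * β‖ ≤ K * n) : α = 0 := by
  refine JT.lim_one (K := K + ‖β‖) fun n hn => ?_
  have hn0 : (0 : ℝ) < n := by exact_mod_cast hn
  have h1 : ‖(n : ℂ) * α + β‖ ≤ K := by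
    have := h n hn
    rw [show (n : ℂ) ^ 2 * α + n * β = n * (n * α + β) by ring, norm_mul, Complex.norm_natCast,
      mul_comm] at this
    exact le_of_mul_le_mul_right this hn0
  have h2 : ‖(n : ℂ) * α‖ ≤ ‖(n : ℂ) * α + β‖ + ‖β‖ := by
    simpa using norm_sub_le ((n : ℂ) * α + β) β
  rw [norm_mul, Complex.norm_natCast] at h2
  linarith

lemma JT.lim_three {α β γ : ℂ} {K : ℝ}
    (h : ∀ n : ℕ, 1 ≤ n → ‖(n : ℂ) ^ 3 * α + (n : ℂ) ^ 2 * β + n * γ‖ ≤ K * n) : α = 0 := by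
  refine JT.lim_two (β := β) (K := K + ‖γ‖) fun n hn => ?_
  have hn0 : (0 : ℝ) < n := by exact_mod_cast hn
  have hn1 : (1 : ℝ) ≤ n := by exact_mod_cast hn
  have h1 : ‖(n : ℂ) ^ 2 * α + n * β + γ‖ ≤ K := by
    have := h n hn
    rw [show (n : ℂ) ^ 3 * α + (n : ℂ) ^ 2 * β + n * γ = n * ((n : ℂ) ^ 2 * α + n * β + γ) by ring,
      norm_mul, Complex.norm_natCast, mul_comm] at this
    exact le_of_mul_le_mul_right this hn0
  have h2 : ‖(n : ℂ) ^ 2 * α + n * β‖ ≤ ‖(n : ℂ) ^ 2 * α + n * β + γ‖ + ‖γ‖ := by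
    generalize (n : ℂ) ^ 2 * α + n * β = w
    have h4 := norm_sub_le (w + γ) γ
    have h5 : w + γ - γ = w := by ring
    rwa [h5] at h4
  have h3 : 0 ≤ K + ‖γ‖ := by linarith [norm_nonneg ((n : ℂ) ^ 2 * α + n * β + γ), norm_nonneg γ]
  nlinarith

variable {A B : Type*} [CStarAlgebra A] [PartialOrder A] [StarOrderedRing A]
  [NormedRing B] [NormedAlgebra ℂ B] [CompleteSpace B]

set_option linter.unusedSectionVars false in
lemma JT.specRad_le (T : B →ₗ[ℂ] A) (hT1 : T 1 = 1)
    (hTinv : ∀ x : B, IsUnit x → IsUnit (T x)) (w : B) :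
    spectralRadius ℂ (T w) ≤ ENNReal.ofReal (‖w‖ * ‖(1 : B)‖) := by
  refine iSup₂_le fun k hk => ?_
  have hk' : k ∈ spectrum ℂ w := by
    rw [spectrum.mem_iff] at hk ⊢
    intro h
    apply hk
    have := hTinv _ h
    rwa [map_sub, Algebra.algebraMap_eq_smul_one, map_smul, hT1,
      ← Algebra.algebraMap_eq_smul_one] at this
  have := spectrum.norm_le_norm_mul_of_mem hk'
  rw [← enorm_eq_nnnorm, ← ofReal_norm]
  exact ENNReal.ofReal_le_ofReal this

set_option maxHeartbeats 1000000 in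
lemma JT.estimate (τ : A →L[ℂ] ℂ) (htr : ∀ a b, τ (a * b) = τ (b * a))
    (hpos : ∀ a, 0 ≤ a → 0 ≤ τ a) (h1 : τ 1 = 1)
    (hstar : ∀ a, τ (star a) = star (τ a))
    (T : B →ₗ[ℂ] A) (hT1 : T 1 = 1)
    (hTinv : ∀ x : B, IsUnit x → IsUnit (T x)) (x y : B) :
    ∃ K : ℝ, ∀ n : ℕ, 1 ≤ n → ∀ P : B[X], P = (1 + C x * X) ^ n * (1 + C y * X) ^ n →
    ‖2 * τ (T (P.coeff 2)) - τ (T (P.coeff 1) * T (P.coeff 1))‖ ≤ K * n ∧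
    ‖6 * τ (T (P.coeff 3)) - 6 * τ (T (P.coeff 1) * T (P.coeff 2))
      + 2 * τ (T (P.coeff 1) * T (P.coeff 1) * T (P.coeff 1))‖ ≤ K * n := by
  set R : ℝ := (‖x‖ + ‖y‖ + 1)⁻¹ with hRdef
  have hR : 0 < R := by positivity
  set D : ℝ := ‖(1 : B)‖ + 2 with hD
  have hD2 : 1 < D := by linarith [norm_nonneg (1 : B)]
  have hlD : 0 < Real.log D := Real.log_pos hD2
  refine ⟨max (2 * (2 * (3 * Real.log D)) / (R / 2) ^ 2) (6 * (2 * (3 * Real.log D)) / (R / 2) ^ 3),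
    fun n hn P hP => ?_⟩
  have hn0 : (0 : ℝ) < n := by exact_mod_cast hn
  set N := P.natDegree + 4 with hN
  set a : ℕ → A := fun k => T (P.coeff k) with ha
  set F : ℂ → A := fun z => ∑ k ∈ Finset.range N, z ^ k • a k with hF
  set F1 : ℂ → A := fun z => ∑ k ∈ Finset.range N, ((k : ℂ) * z ^ (k - 1)) • a k with hF1
  set F2 : ℂ → A := fun z => ∑ k ∈ Finset.range N,
    ((k : ℂ) * (((k - 1 : ℕ) : ℂ) * z ^ (k - 1 - 1))) • a k with hF2
  set F3 : ℂ → A := fun z => ∑ k ∈ Finset.range N,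
    ((k : ℂ) * (((k - 1 : ℕ) : ℂ) * (((k - 1 - 1 : ℕ) : ℂ) * z ^ (k - 1 - 1 - 1)))) • a k with hF3
  have d1 : ∀ z, HasDerivAt F (F1 z) z := fun z =>
    HasDerivAt.fun_sum fun k _ => (hasDerivAt_pow k z).smul_const (a k)
  have d2 : ∀ z, HasDerivAt F1 (F2 z) z := fun z =>
    HasDerivAt.fun_sum fun k _ => ((hasDerivAt_pow (k - 1) z).const_mul (k : ℂ)).smul_const (a k)
  have d3 : ∀ z, HasDerivAt F2 (F3 z) z := fun z =>
    HasDerivAt.fun_sum fun k _ => (((hasDerivAt_pow (k - 1 - 1) z).const_mul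
      ((k - 1 : ℕ) : ℂ)).const_mul (k : ℂ)).smul_const (a k)
  have hz : ∀ m : ℕ, (0 : ℂ) ^ m = if m = 0 then 1 else 0 := fun m => zero_pow_eq m
  have v0 : F 0 = a 0 := by
    simp only [hF]
    rw [Finset.sum_eq_single 0]
    · simp
    · intro k _ hk; simp [hk]
    · intro h; exact absurd (Finset.mem_range.2 (by omega)) h
  have v1 : F1 0 = a 1 := by
    simp only [hF1]
    rw [Finset.sum_eq_single 1]
    · simp
    · intro k _ hk
      rcases k with _ | _ | k <;> first | exact absurd rfl hk | simp
    · intro h; exact absurd (Finset.mem_range.2 (by omega)) h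
  have v2 : F2 0 = (2 : ℂ) • a 2 := by
    simp only [hF2]
    rw [Finset.sum_eq_single 2]
    · simp
    · intro k _ hk
      rcases k with _ | _ | _ | k <;> first | exact absurd rfl hk | simp
    · intro h; exact absurd (Finset.mem_range.2 (by omega)) h
  have v3 : F3 0 = (6 : ℂ) • a 3 := by
    simp only [hF3]
    rw [Finset.sum_eq_single 3]
    · norm_num
    · intro k _ hk
      rcases k with _ | _ | _ | _ | k <;> first | exact absurd rfl hk | simp
    · intro h; exact absurd (Finset.mem_range.2 (by omega)) h
  have hcomm : ∀ (z : ℂ) (c : B), Commute c (algebraMap ℂ B z) := fun z c =>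
    (Algebra.commutes z c).symm
  have hlin : ∀ (z : ℂ) (u : B) (m : ℕ),
      ((1 + C u * X : B[X]) ^ m).eval (algebraMap ℂ B z) = (1 + z • u) ^ m := by
    intro z u m
    induction m with
    | zero => simp
    | succ m ih =>
      rw [pow_succ, eval, eval₂_mul_noncomm _ _ (fun k => hcomm z _), ← eval, ← eval, ih, pow_succ]
      congr 1
      simp [Algebra.smul_def, Algebra.commutes]
  have hev : ∀ z, F z = T ((1 + z • x) ^ n * (1 + z • y) ^ n) := by
    intro z
    rw [← hlin, ← hlin]
    have : ((1 + C x * X : B[X]) ^ n).eval (algebraMap ℂ B z)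
        * ((1 + C y * X : B[X]) ^ n).eval (algebraMap ℂ B z) = P.eval (algebraMap ℂ B z) := by
      rw [hP]
      conv_rhs => rw [eval, eval₂_mul_noncomm _ _ (fun k => hcomm z _), ← eval, ← eval]
    rw [this, eval_eq_sum_range' (n := N) (by omega), map_sum]
    refine Finset.sum_congr rfl fun k _ => ?_
    rw [← map_pow, ← Algebra.commutes, ← Algebra.smul_def, map_smul]
  have hF0 : F 0 = 1 := by rw [hev]; simp [hT1]
  have hsm : ∀ z ∈ Metric.ball (0 : ℂ) R, ∀ u : B, ‖u‖ ≤ ‖x‖ + ‖y‖ → ‖z • u‖ < 1 := by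
    intro z hz u hu
    rw [mem_ball_zero_iff] at hz
    rw [norm_smul]
    have : R * (‖x‖ + ‖y‖ + 1) = 1 := inv_mul_cancel₀ (by positivity)
    nlinarith [norm_nonneg z, norm_nonneg u, norm_nonneg x, norm_nonneg y]
  have hunit : ∀ z ∈ Metric.ball (0 : ℂ) R, ∀ u : B, ‖u‖ ≤ ‖x‖ + ‖y‖ → IsUnit (1 + z • u) := by
    intro z hz u hu
    have := isUnit_one_sub_of_norm_lt_one (x := -(z • u)) (by rw [norm_neg]; exact hsm z hz u hu)
    simpa using this
  have hx : ‖x‖ ≤ ‖x‖ + ‖y‖ := by linarith [norm_nonneg y]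
  have hy : ‖y‖ ≤ ‖x‖ + ‖y‖ := by linarith [norm_nonneg x]
  have hpw : ∀ z ∈ Metric.ball (0 : ℂ) R, ∀ u : B, ‖u‖ ≤ ‖x‖ + ‖y‖ →
      ‖(1 + z • u) ^ n‖ ≤ D ^ n := by
    intro z hz u hu
    refine (norm_pow_le' _ hn).trans ?_
    gcongr
    refine (norm_add_le _ _).trans ?_
    linarith [hsm z hz u hu]
  have hcore := JT.complex_core τ htr hpos h1 hstar F F1 F2 F3 d1 d2 d3 hF0 hR
    (M := 3 * n * Real.log D) (by positivity)
    (fun z hz => by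
      rw [hev]
      exact hTinv _ (((hunit z hz x hx).pow n).mul ((hunit z hz y hy).pow n)))
    (fun z hz => by
      rw [hev]
      refine (JT.specRad_le T hT1 hTinv _).trans (ENNReal.ofReal_le_ofReal ?_)
      have e : Real.exp (3 * n * Real.log D) = D ^ n * D ^ n * D ^ n := by
        rw [← pow_add, ← pow_add, ← Real.rpow_natCast, Real.rpow_def_of_pos (by linarith)]
        congr 1
        push_cast
        ring
      rw [e]
      have hD1 : ‖(1 : B)‖ ≤ D ^ n :=
        (by linarith : ‖(1 : B)‖ ≤ D).trans (le_self_pow₀ hD2.le (by omega))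
      gcongr
      refine (norm_mul_le _ _).trans ?_
      gcongr
      · exact hpw z hz x hx
      · exact hpw z hz y hy)
  rw [v1, v2, v3] at hcore
  obtain ⟨c2, c3⟩ := hcore
  constructor
  · rw [map_smul, smul_eq_mul] at c2
    refine c2.trans (le_trans (le_of_eq ?_) (mul_le_mul_of_nonneg_right (le_max_left _ _) hn0.le))
    ring
  · rw [map_smul, smul_eq_mul, mul_smul_comm, map_smul, smul_eq_mul, ← mul_assoc] at c3
    refine le_trans (le_of_eq ?_) (c3.trans (le_trans (le_of_eq ?_)
      (mul_le_mul_of_nonneg_right (le_max_right _ _) hn0.le)))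
    · norm_num [ha]
    · ring

lemma JT.second (τ : A →L[ℂ] ℂ) (htr : ∀ a b, τ (a * b) = τ (b * a))
    (hpos : ∀ a, 0 ≤ a → 0 ≤ τ a) (h1 : τ 1 = 1)
    (hstar : ∀ a, τ (star a) = star (τ a))
    (T : B →ₗ[ℂ] A) (hT1 : T 1 = 1)
    (hTinv : ∀ x : B, IsUnit x → IsUnit (T x)) (x y : B) :
    τ (T (x * y)) = τ (T x * T y) := by
  have main : ∀ x y : B, τ (T (x * x)) + τ (T (y * y)) + 2 * τ (T (x * y))
      - τ ((T x + T y) * (T x + T y)) = 0 := by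
    intro x y
    obtain ⟨K, hK⟩ := JT.estimate τ htr hpos h1 hstar T hT1 hTinv x y
    refine JT.lim_two (β := -(τ (T (x * x)) + τ (T (y * y)))) (K := K) fun n hn => ?_
    have := (hK n hn _ rfl).1
    convert this using 2
    have e1 : ((1 + C x * X : B[X]) ^ n * (1 + C y * X) ^ n).coeff 1 = (n : ℂ) • (x + y) := by
      simp [coeff_mul, Finset.Nat.antidiagonal_succ, JT.coeff_pow, Algebra.smul_def, mul_add,
        add_comm]
    have e2 : ((1 + C x * X : B[X]) ^ n * (1 + C y * X) ^ n).coeff 2 =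
        ((n.choose 2 : ℕ) : ℂ) • (x * x + y * y) + ((n : ℂ) ^ 2) • (x * y) := by
      have hc : x * (n : B) = n * x := (Nat.cast_commute n x).eq.symm
      simp [coeff_mul, Finset.Nat.antidiagonal_succ, JT.coeff_pow, Algebra.smul_def, mul_add, sq]
      rw [show (n : B) * x * (n * y) = n * (x * n) * y by noncomm_ring, hc]
      noncomm_ring
    rw [e1, e2]
    simp only [map_add, map_smul, smul_mul_smul_comm, smul_eq_mul, Nat.cast_choose_two]
    ring
  have a1 := main x 0
  have a2 := main 0 y
  have a3 := main x y
  simp only [map_zero, mul_zero, zero_mul, add_zero, zero_add, add_mul, mul_add, map_add] at a1 a2 a3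
  rw [htr (T y) (T x)] at a3
  linear_combination (a3 - a1 - a2) / 2

lemma JT.third (τ : A →L[ℂ] ℂ) (htr : ∀ a b, τ (a * b) = τ (b * a))
    (hpos : ∀ a, 0 ≤ a → 0 ≤ τ a) (h1 : τ 1 = 1)
    (hstar : ∀ a, τ (star a) = star (τ a))
    (T : B →ₗ[ℂ] A) (hT1 : T 1 = 1)
    (hTinv : ∀ x : B, IsUnit x → IsUnit (T x)) (x : B) :
    τ (T (x * x * x)) = τ (T x * T x * T x) := by
  obtain ⟨K, hK⟩ := JT.estimate τ htr hpos h1 hstar T hT1 hTinv x 0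
  have s := JT.second τ htr hpos h1 hstar T hT1 hTinv x (x * x)
  rw [← mul_assoc] at s
  have main : τ (T (x * x * x)) - 3 * τ (T x * T (x * x)) + 2 * τ (T x * T x * T x) = 0 := by
    refine JT.lim_three (β := -3 * τ (T (x * x * x)) + 3 * τ (T x * T (x * x)))
      (γ := 2 * τ (T (x * x * x))) (K := K) fun n hn => ?_
    have := (hK n hn _ rfl).2
    convert this using 2
    have e : ((1 + C x * X : B[X]) ^ n * (1 + C 0 * X) ^ n) = (1 + C x * X : B[X]) ^ n := by simp
    have e1 : ((1 + C x * X : B[X]) ^ n).coeff 1 = (n : ℂ) • x := by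
      simp [JT.coeff_pow, Algebra.smul_def]
    have e2 : ((1 + C x * X : B[X]) ^ n).coeff 2 = ((n.choose 2 : ℕ) : ℂ) • (x * x) := by
      simp [JT.coeff_pow, Algebra.smul_def, sq]
    have e3 : ((1 + C x * X : B[X]) ^ n).coeff 3 = ((n.choose 3 : ℕ) : ℂ) • (x * x * x) := by
      simp [JT.coeff_pow, Algebra.smul_def, pow_succ]
    rw [e, e1, e2, e3]
    simp only [map_smul, smul_mul_smul_comm, smul_eq_mul, Nat.cast_choose_two]
    linear_combination (-τ (T (x * x * x))) * JT.choose_three n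
  linear_combination (main - 3 * s) / (-2)

lemma JT.final (τ : A →L[ℂ] ℂ) (htr : ∀ a b, τ (a * b) = τ (b * a))
    (hpos : ∀ a, 0 ≤ a → 0 ≤ τ a) (h1 : τ 1 = 1)
    (hstar : ∀ a, τ (star a) = star (τ a))
    (T : B →ₗ[ℂ] A) (hT1 : T 1 = 1)
    (hTinv : ∀ x : B, IsUnit x → IsUnit (T x)) (x y : B) :
    τ ((T (x * x) - T x * T x) * T y) = 0 := by
  have s := JT.second τ htr hpos h1 hstar T hT1 hTinv
  have c := JT.third τ htr hpos h1 hstar T hT1 hTinv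
  have tr : ∀ u v : B, τ (T (u * v)) = τ (T (v * u)) := fun u v => by rw [s, s, htr]
  have c1 := c (x + y)
  have c2 := c (x - y)
  have c3 := c y
  simp only [add_mul, mul_add, sub_mul, mul_sub, map_add, map_sub] at c1 c2 c3 ⊢
  have t1 : τ (T (x * y * x)) = τ (T (x * x * y)) := by rw [tr, mul_assoc]
  have t2 : τ (T (y * x * x)) = τ (T (x * x * y)) := by rw [mul_assoc, tr]
  have u1 : τ (T x * T y * T x) = τ (T x * T x * T y) := by rw [htr, mul_assoc]
  have u2 : τ (T y * T x * T x) = τ (T x * T x * T y) := by rw [mul_assoc, htr]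
  rw [t1, t2, u1, u2] at c1 c2
  rw [← s]
  linear_combination (c1 - c2 - 2 * c3) / 6
end alg

/-- Every surjective unital invertibility-preserving linear map from a unital complex
Banach algebra onto a unital C*-algebra carrying a faithful *family* of tracial states
is a Jordan homomorphism. -/
theorem jordan_of_invertibility_preserving_faithful_family
    {B A : Type*} [NormedRing B] [NormedAlgebra ℂ B] [CompleteSpace B]
    [CStarAlgebra A]
    {ι : Type*} (τ : ι → A →ₗ[ℂ] ℂ)
    (hτ1 : ∀ i, τ i 1 = 1)
    (hτtrace : ∀ i, ∀ a b : A, τ i (a * b) = τ i (b * a))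
    (hτpos : ∀ i, ∀ a : A, 0 ≤ τ i (star a * a))
    (hτfaithful : ∀ a : A, (∀ i, τ i (star a * a) = 0) → a = 0)
    (T : B →ₗ[ℂ] A)
    (hTsurj : Function.Surjective T)
    (hT1 : T 1 = 1)
    (hTinv : ∀ x : B, IsUnit x → IsUnit (T x)) :
    ∀ a : B, T (a * a) = T a * T a := by
  intro x
  let _ := CStarAlgebra.spectralOrder A
  have _ := CStarAlgebra.spectralOrderedRing A
  rw [← sub_eq_zero]
  apply hτfaithful
  intro i
  obtain ⟨y, hy⟩ := hTsurj (star (T (x * x) - T x * T x))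
  have hpos : ∀ a, 0 ≤ a → 0 ≤ τ i a := by
    intro a ha
    obtain ⟨b, rfl⟩ := CStarAlgebra.nonneg_iff_eq_star_mul_self.1 ha
    exact hτpos i b
  have hcont : Continuous (τ i) := map_continuous (PositiveLinearMap.mk₀ (τ i) hpos)
  have hsa : ∀ a : A, IsSelfAdjoint a → star (τ i a) = τ i a := by
    intro a ha
    have h1 := hpos _ (CFC.posPart_nonneg a)
    have h2 := hpos _ (CFC.negPart_nonneg a)
    rw [← CFC.posPart_sub_negPart a ha, map_sub, star_sub,
      (IsSelfAdjoint.of_nonneg h1).star_eq, (IsSelfAdjoint.of_nonneg h2).star_eq]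
  have hstar : ∀ a, τ i (star a) = star (τ i a) := by
    intro a
    have e1 := hsa _ (realPart a).2
    have e2 := hsa _ (imaginaryPart a).2
    conv_rhs => rw [← realPart_add_I_smul_imaginaryPart a]
    conv_lhs => rw [← realPart_add_I_smul_imaginaryPart a]
    rw [star_add, star_smul, (realPart a).2.star_eq, (imaginaryPart a).2.star_eq, map_add, map_add, map_smul, map_smul,
      star_add, star_smul, e1, e2]
  have := JT.final (⟨τ i, hcont⟩ : A →L[ℂ] ℂ) (hτtrace i) hpos (hτ1 i) hstar T hT1 hTinv x y
  rw [hy] at this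
  rw [hτtrace]
  exact this
end

section
/- Let T be a surjective linear mapping between two semisimple unital complex Banach algebras B and A that preserves the spectrum of each element, i.e., σ(T x) = σ(x) for all x ∈ B. If A (or B) is a unital C*-algebra equipped with a faithful tracial state, then T is a Jordan isomorphism, i.e., T is bijective and T(a²) = (T a)² for all a ∈ B. -/
open scoped ComplexOrder

namespace SpecJordan

section tracial
variable {A : Type*} [CStarAlgebra A]

lemma tau_star (τ : A →ₗ[ℂ] ℂ) (hτ1 : τ 1 = 1) (hτpos : ∀ a : A, 0 ≤ τ (star a * a)) (a : A) :
    τ (star a) = star (τ a) := by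
  have him : ∀ b : A, (τ (star b * b)).im = 0 := fun b => by
    have := (Complex.le_def.1 (hτpos b)).2
    simpa using this.symm
  have h1 := him (1 + a)
  have h2 := him (1 + Complex.I • a)
  have h3 := him a
  simp [mul_add, add_mul, hτ1, h3, smul_smul] at h1 h2
  apply Complex.ext
  · simp; linarith
  · simp; linarith

lemma tau_cont (τ : A →ₗ[ℂ] ℂ) (hτpos : ∀ a : A, 0 ≤ τ (star a * a)) : Continuous τ := by
  let _ := CStarAlgebra.spectralOrder A
  let _ := CStarAlgebra.spectralOrderedRing A
  let f : A →ₚ[ℂ] ℂ := PositiveLinearMap.mk₀ τ (by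
    intro a ha
    obtain ⟨b, rfl⟩ := (CStarAlgebra.nonneg_iff_eq_star_mul_self).1 ha
    exact hτpos b)
  exact map_continuous f

lemma tau_D [Nontrivial A] (τ : A →ₗ[ℂ] ℂ) (hτpos : ∀ a : A, 0 ≤ τ (star a * a))
    (a : A) (ha : IsUnit a) (M : ℝ) (hM : 0 < M) (haM : ‖a‖ ≤ M) :
    ‖1 - (M ^ 2)⁻¹ • (star a * a)‖ < 1 ∧
      ∀ n : ℕ, 0 ≤ τ ((1 - (M ^ 2)⁻¹ • (star a * a)) ^ n) := by
  let _ := CStarAlgebra.spectralOrder A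
  let _ := CStarAlgebra.spectralOrderedRing A
  set D := 1 - (M ^ 2)⁻¹ • (star a * a) with hD
  have hG0 : 0 ≤ (M ^ 2)⁻¹ • (star a * a) := smul_nonneg (by positivity) (star_mul_self_nonneg a)
  have hGn : ‖(M ^ 2)⁻¹ • (star a * a)‖ ≤ 1 := by
    rw [norm_smul, CStarRing.norm_star_mul_self, Real.norm_of_nonneg (by positivity),
      inv_mul_le_iff₀ (by positivity)]
    nlinarith [norm_nonneg a]
  have hD0 : 0 ≤ D := by
    rw [hD, sub_nonneg]
    exact (CStarAlgebra.norm_le_one_iff_of_nonneg _ hG0).1 hGn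
  have hD1 : ‖D‖ ≤ 1 := by
    rw [CStarAlgebra.norm_le_one_iff_of_nonneg _ hD0, hD]
    exact sub_le_self _ hG0
  refine ⟨lt_of_le_of_ne hD1 ?_, ?_⟩
  · intro h
    have := CStarAlgebra.norm_mem_spectrum_of_nonneg hD0
    rw [h, spectrum.mem_iff] at this
    apply this
    simp only [map_one, hD, sub_sub_cancel]
    have hu : IsUnit (star a * a) := ha.star.mul ha
    have h0 : (M^2)⁻¹ ≠ 0 := by positivity
    exact (IsUnit.smul (Units.mk0 _ h0) hu)
  · intro n
    obtain ⟨b, hb⟩ := (CStarAlgebra.nonneg_iff_eq_star_mul_self).1 (CStarAlgebra.pow_nonneg hD0 n)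
    rw [hb]; exact hτpos b

lemma tau_pow_deriv (τ : A →L[ℂ] ℂ) (htr : ∀ a b : A, τ (a * b) = τ (b * a))
    {D : ℝ → A} {D' : A} {t : ℝ} (h : HasDerivAt D D' t) (n : ℕ) :
    HasDerivAt (fun s => τ (D s ^ (n + 1))) ((n + 1 : ℂ) * τ (D t ^ n * D')) t := by
  have h1 := h.fun_pow' (n + 1)
  have h2 := ((τ.restrictScalars ℝ).hasFDerivAt (x := D t ^ (n+1))).comp_hasDerivAt t h1
  convert! h2 using 1
  simp only [ContinuousLinearMap.coe_restrictScalars', map_sum, Nat.pred_eq_sub_one,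
    Nat.add_sub_cancel]
  rw [Finset.sum_congr rfl (g := fun _ => τ (D t ^ n * D'))]
  · simp
  · intro i hi
    rw [htr, ← mul_assoc, ← pow_add]
    congr 3
    have := Finset.mem_range.1 hi
    omega

/-- Fuglede–Kadison type estimate along a path. -/
lemma path_norm [Nontrivial A] (τ : A →L[ℂ] ℂ) (hτ1 : τ 1 = 1) (htr : ∀ a b : A, τ (a * b) = τ (b * a))
    (hτpos : ∀ a : A, 0 ≤ τ (star a * a))
    (f f' : ℝ → A) (h : ℝ → ℂ) (M : ℝ) (hM : 0 < M)
    (hf : ∀ t ∈ Set.Icc (0:ℝ) 1, HasDerivAt f (f' t) t)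
    (hf' : ContinuousOn f' (Set.Icc 0 1))
    (hu : ∀ t ∈ Set.Icc (0:ℝ) 1, IsUnit (f t)) (hf0 : f 0 = 1)
    (hfM : ∀ t ∈ Set.Icc (0:ℝ) 1, ‖f t‖ ≤ M)
    (hh : ∀ t ∈ Set.Icc (0:ℝ) 1, HasDerivAt h (τ (Ring.inverse (f t) * f' t)) t)
    (hh0 : h 0 = 0) : (h 1).re ≤ Real.log M := by
  have hstar : ∀ a, τ (star a) = star (τ a) := tau_star τ.toLinearMap hτ1 hτpos
  set c : ℝ := (M ^ 2)⁻¹ with hc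
  have hcpos : 0 < c := by positivity
  set G : ℝ → A := fun t => star (f t) * f t with hG
  set G' : ℝ → A := fun t => star (f' t) * f t + star (f t) * f' t with hG'
  have hGd : ∀ t ∈ Set.Icc (0:ℝ) 1, HasDerivAt G (G' t) t := by
    intro t ht
    exact ((hf t ht).star).mul (hf t ht)
  set D : ℝ → A := fun t => 1 - c • G t with hD
  have hDd : ∀ t ∈ Set.Icc (0:ℝ) 1, HasDerivAt D (-(c • G' t)) t := by
    intro t ht
    simpa using ((hGd t ht).const_smul c).const_sub 1
  have hDprop : ∀ t ∈ Set.Icc (0:ℝ) 1, ‖D t‖ < 1 ∧ ∀ n : ℕ, 0 ≤ τ (D t ^ n) := fun t ht =>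
    tau_D τ.toLinearMap hτpos (f t) (hu t ht) M hM (hfM t ht)
  have hfc : ContinuousOn f (Set.Icc 0 1) := fun t ht => (hf t ht).continuousAt.continuousWithinAt
  have hDc : ContinuousOn D (Set.Icc 0 1) := fun t ht => (hDd t ht).continuousAt.continuousWithinAt
  set W : ℝ → A := fun t => Ring.inverse (f t) * star (Ring.inverse (f t)) * G' t with hW
  have hVc : ContinuousOn (fun t => Ring.inverse (f t)) (Set.Icc 0 1) := by
    intro t ht
    obtain ⟨u, hu'⟩ := hu t ht
    have := NormedRing.inverse_continuousAt u
    rw [hu'] at this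
    exact this.comp_continuousWithinAt (hfc t ht)
  have hWc : ContinuousOn W (Set.Icc 0 1) := by
    have h2 : ContinuousOn G' (Set.Icc 0 1) := (hf'.star.mul hfc).add (hfc.star.mul hf')
    exact (hVc.mul hVc.star).mul h2
  obtain ⟨t0, ht0, hmax⟩ := isCompact_Icc.exists_isMaxOn (Set.nonempty_Icc.2 zero_le_one) hDc.norm
  obtain ⟨t1, ht1, hmaxW⟩ := isCompact_Icc.exists_isMaxOn (Set.nonempty_Icc.2 zero_le_one) hWc.norm
  set q := ‖D t0‖ with hq
  have hq1 : q < 1 := (hDprop t0 ht0).1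
  set C := ‖W t1‖ with hC
  -- algebra
  have hVf : ∀ t ∈ Set.Icc (0:ℝ) 1, Ring.inverse (f t) * f t = 1 := fun t ht =>
    Ring.inverse_mul_cancel _ (hu t ht)
  have hfV : ∀ t ∈ Set.Icc (0:ℝ) 1, f t * Ring.inverse (f t) = 1 := fun t ht =>
    Ring.mul_inverse_cancel _ (hu t ht)
  have hGW : ∀ t ∈ Set.Icc (0:ℝ) 1, G t * W t = G' t := by
    intro t ht
    have h1 := hfV t ht
    have h2 : star (f t) * star (Ring.inverse (f t)) = 1 := by
      rw [← star_mul, hVf t ht, star_one]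
    calc G t * W t = star (f t) * (f t * Ring.inverse (f t)) * star (Ring.inverse (f t)) * G' t := by
          simp only [hG, hW, mul_assoc]
      _ = G' t := by rw [h1, mul_one, h2, one_mul]
  have hτW : ∀ t ∈ Set.Icc (0:ℝ) 1, τ (W t) = τ (Ring.inverse (f t) * f' t)
      + star (τ (Ring.inverse (f t) * f' t)) := by
    intro t ht
    have h1 := hfV t ht
    have h2 : star (Ring.inverse (f t)) * star (f t) = 1 := by
      rw [← star_mul, h1, star_one]
    have e1 : τ (Ring.inverse (f t) * star (Ring.inverse (f t)) * (star (f' t) * f t))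
        = star (τ (Ring.inverse (f t) * f' t)) := by
      rw [htr]
      rw [show star (f' t) * f t * (Ring.inverse (f t) * star (Ring.inverse (f t)))
        = star (f' t) * (f t * Ring.inverse (f t)) * star (Ring.inverse (f t)) by
          simp only [mul_assoc], h1, mul_one, ← star_mul, hstar]
    have e2 : Ring.inverse (f t) * star (Ring.inverse (f t)) * (star (f t) * f' t)
        = Ring.inverse (f t) * f' t := by
      rw [show Ring.inverse (f t) * star (Ring.inverse (f t)) * (star (f t) * f' t)
        = Ring.inverse (f t) * (star (Ring.inverse (f t)) * star (f t)) * f' t by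
          simp only [mul_assoc], h2, mul_one]
    simp only [hW, hG', mul_add, map_add, e1, e2]
    ring
  -- truncated logarithm
  let L : ℕ → ℝ → ℂ := fun N t => ∑ n ∈ Finset.range N, -((n + 1 : ℂ)⁻¹ * τ (D t ^ (n + 1)))
  have hLd : ∀ N, ∀ t ∈ Set.Icc (0:ℝ) 1, HasDerivAt (L N) (τ (W t) - τ (D t ^ N * W t)) t := by
    intro N t ht
    have : HasDerivAt (L N) (∑ n ∈ Finset.range N,
        -((n + 1 : ℂ)⁻¹ * ((n + 1 : ℂ) * τ (D t ^ n * (-(c • G' t)))))) t := by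
      apply HasDerivAt.fun_sum
      intro n _
      exact ((tau_pow_deriv τ htr (hDd t ht) n).const_mul _).neg
    convert! this using 1
    rw [Finset.sum_congr rfl (g := fun n => τ (D t ^ n * (c • G' t)))]
    · rw [← map_sum, ← Finset.sum_mul, ← map_sub]
      congr 1
      have e : c • G' t = (1 - D t) * W t := by
        simp only [hD, sub_sub_cancel, smul_mul_assoc, hGW t ht]
      rw [e, ← mul_assoc (∑ i ∈ Finset.range N, D t ^ i), geom_sum_mul_neg, sub_mul, one_mul]
    · intro n _
      have : (n + 1 : ℂ) ≠ 0 := by exact_mod_cast Nat.succ_ne_zero n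
      rw [← mul_assoc, inv_mul_cancel₀ this, one_mul, mul_neg, map_neg, neg_neg]
  have key : ∀ N : ℕ, 2 * (h 1).re ≤ ‖τ‖ * (q ^ N * C) + 2 * Real.log M := by
    intro N
    have hψ := norm_image_sub_le_of_norm_deriv_le_segment_01'
      (f := fun t => L N t - (h t + star (h t)))
      (f' := fun t => (τ (W t) - τ (D t ^ N * W t)) - (τ (Ring.inverse (f t) * f' t)
        + star (τ (Ring.inverse (f t) * f' t)))) (C := ‖τ‖ * (q ^ N * C))
      (fun t ht => ((hLd N t ht).sub ((hh t ht).add (hh t ht).star)).hasDerivWithinAt)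
      (by
        intro t ht'
        have ht := Set.Ico_subset_Icc_self ht'
        rw [← hτW t ht]
        simp only [sub_sub_cancel_left, norm_neg]
        refine (τ.le_opNorm _).trans ?_
        gcongr
        refine (norm_mul_le _ _).trans ?_
        gcongr
        · refine (norm_pow_le _ _).trans ?_
          gcongr
          exact hmax ht
        · exact hmaxW ht)
    have hL1 : (L N 1).re ≤ 0 := by
      simp only [L, Complex.re_sum]
      apply Finset.sum_nonpos
      intro n _
      have h1 := (hDprop 1 (by simp)).2 (n + 1)
      have h2 : (0:ℂ) ≤ (n + 1 : ℂ)⁻¹ := by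
        have : (0:ℂ) ≤ ((n + 1 : ℝ)⁻¹ : ℝ) := by
          rw [Complex.zero_le_real]; positivity
        simpa using this
      have h3 := (Complex.le_def.1 (mul_nonneg h2 h1)).1
      rw [Complex.neg_re]
      simpa using h3
    have hM1 : 1 ≤ M := by
      have := hfM 0 (by simp)
      rw [hf0, CStarRing.norm_one] at this
      exact this
    have hc1 : c ≤ 1 := by
      rw [hc]; apply inv_le_one_of_one_le₀; nlinarith
    have hL0 : -(2 * Real.log M) ≤ (L N 0).re := by
      have hD0 : D 0 = algebraMap ℂ A ((1 - c : ℝ) : ℂ) := by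
        simp only [hD, hG, hf0, star_one, mul_one]
        rw [Complex.ofReal_sub, map_sub]
        simp [Algebra.algebraMap_eq_smul_one]
      have hLr : (L N 0).re = - ∑ n ∈ Finset.range N, (1 - c) ^ (n + 1) / (n + 1) := by
        have : L N 0 = ((- ∑ n ∈ Finset.range N, (1 - c) ^ (n + 1) / (n + 1) : ℝ) : ℂ) := by
          simp only [L]
          push_cast
          rw [Finset.sum_neg_distrib]
          congr 1
          apply Finset.sum_congr rfl
          intro n _
          rw [hD0, ← map_pow, Algebra.algebraMap_eq_smul_one, map_smul, hτ1]
          push_cast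
          simp only [smul_eq_mul, mul_one]
          field_simp
        rw [this, Complex.ofReal_re]
      rw [hLr, neg_le_neg_iff]
      have hlog := Real.hasSum_pow_div_log_of_abs_lt_one (x := 1 - c) (by
        rw [abs_lt]; constructor <;> linarith)
      have := hlog.summable.sum_le_tsum (Finset.range N) (fun n _ => by
        have : 0 ≤ 1 - c := by linarith
        positivity)
      rw [hlog.tsum_eq] at this
      refine this.trans (le_of_eq ?_)
      rw [sub_sub_cancel, hc, Real.log_inv, Real.log_pow]
      simp
    have hre := (Complex.abs_re_le_norm _).trans hψ
    have := (abs_le.1 hre).1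
    simp [hh0] at this
    linarith
  have hlim : Filter.Tendsto (fun N : ℕ => ‖τ‖ * (q ^ N * C) + 2 * Real.log M) Filter.atTop
      (nhds (‖τ‖ * (0 * C) + 2 * Real.log M)) := by
    have := tendsto_pow_atTop_nhds_zero_of_lt_one (norm_nonneg (D t0)) hq1
    exact ((this.mul_const C).const_mul _).add_const _
  have := ge_of_tendsto' hlim key
  linarith

end tracial

section analytic
variable {A : Type*} [CStarAlgebra A]

lemma unif_pow (f : ℝ → A) (hf : ContinuousOn f (Set.Icc 0 1)) (K : ℝ) (hK : 0 < K)
    (hr : ∀ t ∈ Set.Icc (0:ℝ) 1, spectralRadius ℂ (f t) < ENNReal.ofReal K) :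
    ∃ N : ℕ, 1 ≤ N ∧ ∀ t ∈ Set.Icc (0:ℝ) 1, ‖f t ^ N‖ ≤ K ^ N := by
  refine isCompact_Icc.induction_on (p := fun s => ∃ N : ℕ, 1 ≤ N ∧ ∀ t ∈ s, ‖f t ^ N‖ ≤ K ^ N)
    ⟨1, le_rfl, by simp⟩ ?_ ?_ ?_
  · rintro s t hst ⟨N, hN, h⟩
    exact ⟨N, hN, fun x hx => h x (hst hx)⟩
  · rintro s t ⟨N, hN, h⟩ ⟨N', hN', h'⟩
    refine ⟨N * N', Nat.mul_pos hN hN', ?_⟩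
    rintro x (hx | hx)
    · rw [pow_mul, pow_mul]
      refine (norm_pow_le' _ (by omega)).trans ?_
      gcongr
      exact h x hx
    · rw [mul_comm N, pow_mul, pow_mul]
      refine (norm_pow_le' _ (by omega)).trans ?_
      gcongr
      exact h' x hx
  · intro t ht
    have h1 := spectrum.pow_norm_pow_one_div_tendsto_nhds_spectralRadius (f t)
    have h2 := (h1.eventually (gt_mem_nhds (hr t ht))).and (Filter.eventually_ge_atTop 1)
    obtain ⟨N, hN, hN1⟩ := h2.exists
    have hN' : ‖f t ^ N‖ < K ^ N := by
      have h3 := (ENNReal.ofReal_lt_ofReal_iff hK).1 hN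
      rw [one_div, Real.rpow_inv_lt_iff_of_pos (norm_nonneg _) hK.le (by exact_mod_cast hN1)] at h3
      simpa using h3
    have hc : ContinuousWithinAt (fun s => ‖f s ^ N‖) (Set.Icc 0 1) t := ((hf t ht).pow N).norm
    refine ⟨{s | ‖f s ^ N‖ < K ^ N}, hc.eventually (gt_mem_nhds hN'), N, hN1, ?_⟩
    intro s hs
    exact le_of_lt hs

lemma path_spec [Nontrivial A] (τ : A →L[ℂ] ℂ) (hτ1 : τ 1 = 1)
    (htr : ∀ a b : A, τ (a * b) = τ (b * a))
    (hτpos : ∀ a : A, 0 ≤ τ (star a * a))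
    (f f' : ℝ → A) (h : ℝ → ℂ) (K : ℝ) (hK : 0 < K)
    (hf : ∀ t ∈ Set.Icc (0:ℝ) 1, HasDerivAt f (f' t) t)
    (hf' : ContinuousOn f' (Set.Icc 0 1))
    (hu : ∀ t ∈ Set.Icc (0:ℝ) 1, IsUnit (f t)) (hf0 : f 0 = 1)
    (hfK : ∀ t ∈ Set.Icc (0:ℝ) 1, spectralRadius ℂ (f t) < ENNReal.ofReal K)
    (hh : ∀ t ∈ Set.Icc (0:ℝ) 1, HasDerivAt h (τ (Ring.inverse (f t) * f' t)) t)
    (hh0 : h 0 = 0) : (h 1).re ≤ Real.log K := by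
  have hfc : ContinuousOn f (Set.Icc 0 1) := fun t ht => (hf t ht).continuousAt.continuousWithinAt
  obtain ⟨N, hN, hNb⟩ := unif_pow f hfc K hK hfK
  have hNpos : (0:ℝ) < N := by exact_mod_cast hN
  have := path_norm τ hτ1 htr hτpos (fun t => f t ^ N)
    (fun t => ∑ i ∈ Finset.range N, f t ^ (N.pred - i) * f' t * f t ^ i)
    (fun t => (N : ℂ) * h t) (K ^ N) (by positivity)
    (fun t ht => (hf t ht).fun_pow' N)
    (continuousOn_finsetSum _ fun i _ => ((hfc.pow _).mul hf').mul (hfc.pow _))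
    (fun t ht => (hu t ht).pow N) (by simp [hf0]) hNb
    (by
      intro t ht
      convert! (hh t ht).const_mul (N : ℂ) using 1
      rw [Finset.mul_sum, map_sum, Finset.sum_congr rfl (g := fun _ => τ (Ring.inverse (f t) * f' t))]
      · simp
      · intro i hi
        obtain ⟨u, hu'⟩ := hu t ht
        rw [← hu', ← mul_assoc, htr, ← mul_assoc, ← mul_assoc, ← Units.val_pow_eq_pow_val,
          ← Units.val_pow_eq_pow_val, ← Units.val_pow_eq_pow_val, Ring.inverse_unit, Ring.inverse_unit,
          ← Units.val_mul, ← Units.val_mul]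
        congr 3
        have := Finset.mem_range.1 hi
        obtain ⟨j, rfl⟩ : ∃ j, N = i + 1 + j := ⟨N - (i + 1), by omega⟩
        rw [show (i + 1 + j).pred - i = j by simp]
        group)
    (by simp [hh0])
  rw [Real.log_pow] at this
  have h2 : ((N:ℂ) * h 1).re = N * (h 1).re := by
    rw [← Complex.ofReal_natCast, Complex.re_ofReal_mul]
  rw [h2] at this
  exact le_of_mul_le_mul_left this hNpos

lemma disc_bound [Nontrivial A] (τ : A →L[ℂ] ℂ) (hτ1 : τ 1 = 1)
    (htr : ∀ a b : A, τ (a * b) = τ (b * a))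
    (hτpos : ∀ a : A, 0 ≤ τ (star a * a))
    (F F1 F2 : ℂ → A) (R K : ℝ) (hR : 0 < R) (hK : 1 < K)
    (hF : ∀ z, HasDerivAt F (F1 z) z) (hF1 : ∀ z, HasDerivAt F1 (F2 z) z)
    (hu : ∀ z ∈ Metric.ball (0:ℂ) R, IsUnit (F z)) (hF0 : F 0 = 1)
    (hr : ∀ z ∈ Metric.ball (0:ℂ) R, spectralRadius ℂ (F z) < ENNReal.ofReal K) :
    ∃ h : ℂ → ℂ, (∀ z ∈ Metric.ball (0:ℂ) R, HasDerivAt h (τ (Ring.inverse (F z) * F1 z)) z) ∧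
      ∀ k : ℕ, ‖iteratedDeriv k h 0‖ ≤ k.factorial * (2 * Real.log K) / (R / 2) ^ k := by
  have hg : DifferentiableOn ℂ (fun z => τ (Ring.inverse (F z) * F1 z)) (Metric.ball 0 R) := by
    intro z hz
    apply DifferentiableAt.differentiableWithinAt
    obtain ⟨u, hu'⟩ := hu z hz
    have h1 := (hasFDerivAt_ringInverse (𝕜 := ℂ) u).differentiableAt
    rw [hu'] at h1
    have h2 : DifferentiableAt ℂ (fun z => Ring.inverse (F z)) z :=
      h1.comp z (hF z).differentiableAt
    exact τ.differentiableAt.comp z (h2.mul (hF1 z).differentiableAt)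
  obtain ⟨h, hh0, hh⟩ := hg.isExactOn_ball.with_val_at 0 0
  refine ⟨h, hh, ?_⟩
  have hlog : 0 < Real.log K := Real.log_pos hK
  have hre : Set.MapsTo h (Metric.ball 0 R) {z | z.re ≤ Real.log K} := by
    intro z hz
    have hmem : ∀ t ∈ Set.Icc (0:ℝ) 1, (t : ℂ) * z ∈ Metric.ball (0:ℂ) R := by
      intro t ht
      rw [mem_ball_zero_iff] at hz ⊢
      rw [norm_mul, Complex.norm_real, Real.norm_of_nonneg ht.1]
      exact lt_of_le_of_lt (mul_le_of_le_one_left (norm_nonneg z) ht.2) hz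
    have hlin : ∀ t : ℝ, HasDerivAt (fun t : ℝ => (t : ℂ) * z) z t := by
      intro t
      simpa using (Complex.ofRealCLM.hasDerivAt (x := t)).mul_const z
    have := path_spec τ hτ1 htr hτpos (fun t => F (t * z)) (fun t => z • F1 (t * z))
      (fun t => h (t * z)) K (by linarith)
      (fun t _ => (hF _).scomp t (hlin t))
      (by
        have : Continuous F1 := continuous_iff_continuousAt.2 fun z => (hF1 z).continuousAt
        exact (Continuous.const_smul (this.comp (by fun_prop)) z).continuousOn)
      (fun t ht => hu _ (hmem t ht)) (by simp [hF0]) (fun t ht => hr _ (hmem t ht))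
      (by
        intro t ht
        convert! (hh _ (hmem t ht)).scomp t (hlin t) using 1
        simp)
      (by simp [hh0])
    simpa using this
  have hd : DifferentiableOn ℂ h (Metric.ball 0 R) := fun z hz =>
    (hh z hz).differentiableAt.differentiableWithinAt
  intro k
  apply Complex.norm_iteratedDeriv_le_of_forall_mem_sphere_norm_le k (by positivity)
  · apply DifferentiableOn.diffContOnCl
    apply hd.mono
    rw [closure_ball _ (by positivity)]
    exact Metric.closedBall_subset_ball (by linarith)
  · intro z hz
    rw [mem_sphere_zero_iff_norm] at hz
    have := Complex.borelCaratheodory_zero hlog hd hre hR (z := z)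
      (by rw [mem_ball_zero_iff, hz]; linarith) hh0
    rw [hz] at this
    refine this.trans (le_of_eq ?_)
    field_simp
    ring

end analytic

section poly
variable {A : Type*} [CStarAlgebra A]

noncomputable def polyE (N : ℕ) (a : ℕ → A) (z : ℂ) : A := ∑ k ∈ Finset.range N, z ^ k • a k

noncomputable def shiftE (a : ℕ → A) (k : ℕ) : A := (k + 1 : ℂ) • a (k + 1)

lemma shiftE_zero {N : ℕ} {a : ℕ → A} (h : ∀ k, N ≤ k → a k = 0) : ∀ k, N ≤ k → shiftE a k = 0 :=
  fun k hk => by simp [shiftE, h (k + 1) (by omega)]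

lemma polyE_zero {N : ℕ} {a : ℕ → A} (h : ∀ k, N ≤ k → a k = 0) : polyE N a 0 = a 0 := by
  rcases N with _ | N
  · simp [polyE, h 0 le_rfl]
  · simp [polyE, Finset.sum_range_succ']

lemma polyE_deriv {N : ℕ} {a : ℕ → A} (h : ∀ k, N ≤ k → a k = 0) (z : ℂ) :
    HasDerivAt (polyE N a) (polyE N (shiftE a) z) z := by
  have h1 : HasDerivAt (polyE N a) (∑ k ∈ Finset.range N, ((k : ℂ) * z ^ (k - 1)) • a k) z := by
    unfold polyE
    apply HasDerivAt.fun_sum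
    intro k _
    exact (hasDerivAt_pow k z).smul_const (a k)
  convert! h1 using 1
  have h2 : ∑ k ∈ Finset.range N, ((k : ℂ) * z ^ (k - 1)) • a k
      = ∑ k ∈ Finset.range (N + 1), ((k : ℂ) * z ^ (k - 1)) • a k := by
    rw [Finset.sum_range_succ, h N le_rfl]; simp
  rw [h2, Finset.sum_range_succ']
  simp [polyE, shiftE, smul_smul, mul_comm]

lemma iter_step {h p p' : ℂ → ℂ} {R : ℝ} (k : ℕ)
    (h1 : ∀ z ∈ Metric.ball (0:ℂ) R, iteratedDeriv k h z = p z)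
    (h2 : ∀ z ∈ Metric.ball (0:ℂ) R, HasDerivAt p (p' z) z) :
    ∀ z ∈ Metric.ball (0:ℂ) R, iteratedDeriv (k + 1) h z = p' z := by
  intro z hz
  rw [iteratedDeriv_succ]
  have : iteratedDeriv k h =ᶠ[nhds z] p := by
    filter_upwards [Metric.isOpen_ball.mem_nhds hz] with w hw using h1 w hw
  rw [this.deriv_eq, (h2 z hz).deriv]

lemma coef_bound [Nontrivial A] (τ : A →L[ℂ] ℂ) (hτ1 : τ 1 = 1)
    (htr : ∀ a b : A, τ (a * b) = τ (b * a))
    (hτpos : ∀ a : A, 0 ≤ τ (star a * a))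
    (N : ℕ) (a : ℕ → A) (ha : ∀ k, N ≤ k → a k = 0) (ha0 : a 0 = 1)
    (R K : ℝ) (hR : 0 < R) (hK : 1 < K)
    (hu : ∀ z ∈ Metric.ball (0:ℂ) R, IsUnit (polyE N a z))
    (hr : ∀ z ∈ Metric.ball (0:ℂ) R, spectralRadius ℂ (polyE N a z) < ENNReal.ofReal K) :
    ‖2 * τ (a 2) - τ (a 1 * a 1)‖ ≤ 2 * (2 * Real.log K) / (R / 2) ^ 2 ∧
    ‖6 * τ (a 3) - 6 * τ (a 1 * a 2) + 2 * τ (a 1 * a 1 * a 1)‖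
      ≤ 6 * (2 * Real.log K) / (R / 2) ^ 3 := by
  set F := polyE N a with hF
  set F1 := polyE N (shiftE a) with hF1
  set F2 := polyE N (shiftE (shiftE a)) with hF2
  set F3 := polyE N (shiftE (shiftE (shiftE a))) with hF3
  have ha1 := shiftE_zero ha
  have ha2 := shiftE_zero ha1
  have ha3 := shiftE_zero ha2
  have d0 : ∀ z, HasDerivAt F (F1 z) z := polyE_deriv ha
  have d1 : ∀ z, HasDerivAt F1 (F2 z) z := polyE_deriv ha1
  have d2 : ∀ z, HasDerivAt F2 (F3 z) z := polyE_deriv ha2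
  have e0 : F 0 = 1 := by rw [hF, polyE_zero ha, ha0]
  have e1 : F1 0 = a 1 := by rw [hF1, polyE_zero ha1]; simp [shiftE]
  have e2 : F2 0 = (2 : ℂ) • a 2 := by
    rw [hF2, polyE_zero ha2]; simp [shiftE]; norm_num
  have e3 : F3 0 = (6 : ℂ) • a 3 := by
    rw [hF3, polyE_zero ha3]; simp [shiftE, smul_smul]; norm_num
  obtain ⟨h, hh, hb⟩ := disc_bound τ hτ1 htr hτpos F F1 F2 R K hR hK d0 d1 hu e0 hr
  set V : ℂ → A := fun z => Ring.inverse (F z) with hV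
  have dV : ∀ z ∈ Metric.ball (0:ℂ) R, HasDerivAt V (-(V z * F1 z * V z)) z := by
    intro z hz
    obtain ⟨u, hu'⟩ := hu z hz
    have h1 := hasFDerivAt_ringInverse (𝕜 := ℂ) u
    rw [hu'] at h1
    have h2 := h1.comp_hasDerivAt z (d0 z)
    convert! h2 using 1
    simp [hV, ← hu']
  have i1 : ∀ z ∈ Metric.ball (0:ℂ) R, iteratedDeriv 1 h z = τ (V z * F1 z) := by
    intro z hz
    rw [iteratedDeriv_one, (hh z hz).deriv]
  have i2 := iter_step 1 i1 (p' := fun z => τ (-(V z * F1 z * V z) * F1 z + V z * F2 z)) (by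
    intro z hz
    exact τ.hasFDerivAt.comp_hasDerivAt z ((dV z hz).mul (d1 z)))
  have i3 := iter_step 2 i2 (p' := fun z => τ (
      (-((-(V z * F1 z * V z) * F1 z + V z * F2 z) * V z + V z * F1 z * (-(V z * F1 z * V z))) * F1 z
        + -(V z * F1 z * V z) * F2 z) + (-(V z * F1 z * V z) * F2 z + V z * F3 z))) (by
    intro z hz
    exact τ.hasFDerivAt.comp_hasDerivAt z
      ((((((dV z hz).mul (d1 z)).mul (dV z hz)).neg).mul (d1 z)).add ((dV z hz).mul (d2 z))))
  have m0 : (0:ℂ) ∈ Metric.ball (0:ℂ) R := Metric.mem_ball_self hR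
  have V0 : V 0 = 1 := by simp [hV, e0]
  constructor
  · have := hb 2
    rw [i2 0 m0] at this
    simp only [V0, e1, e2] at this
    convert this using 2
    · simp
      ring
    · norm_num [Nat.factorial]
  · have := hb 3
    rw [i3 0 m0] at this
    simp only [V0, e1, e2, e3] at this
    convert this using 2
    · have := htr (a 2) (a 1)
      simp [add_mul, this, mul_assoc]
      ring
    · norm_num [Nat.factorial]

end poly

section banach
open Polynomial

lemma exists_unit_add {B : Type*} [NormedRing B] [NormedAlgebra ℂ B] [CompleteSpace B] (y : B) :
    ∃ c : ℂ, c ≠ 0 ∧ IsUnit (y + algebraMap ℂ B c) := by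
  have h0 : ((‖y‖ + 1 : ℝ) : ℂ) ≠ 0 := by
    rw [Complex.ofReal_ne_zero]; positivity
  refine ⟨((‖y‖ + 1 : ℝ) : ℂ), h0, ?_⟩
  have h1 : IsUnit (1 - (-((((‖y‖ + 1 : ℝ) : ℂ))⁻¹ • y))) := by
    apply isUnit_one_sub_of_norm_lt_one
    rw [norm_neg, norm_smul, norm_inv, Complex.norm_real, Real.norm_of_nonneg (by positivity),
      inv_mul_lt_iff₀ (by positivity)]
    linarith
  have h2 := IsUnit.smul (Units.mk0 _ h0) h1
  convert h2 using 1
  rw [Units.smul_mk0, sub_neg_eq_add, smul_add, smul_smul, mul_inv_cancel₀ h0, one_smul,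
    Algebra.algebraMap_eq_smul_one, add_comm]

lemma rad_zero {B : Type*} [NormedRing B] [NormedAlgebra ℂ B] [CompleteSpace B]
    (hss : TwoSidedIdeal.jacobson (⊥ : TwoSidedIdeal B) = ⊥) (x : B)
    (hx : ∀ u : B, IsUnit u → IsUnit (x + u)) : x = 0 := by
  have hmul : ∀ u w : B, IsUnit u → IsUnit w → IsUnit (u * x + w) := by
    rintro _ w ⟨u, rfl⟩ hw
    have := u.isUnit.mul (hx (↑u⁻¹ * w) (u⁻¹.isUnit.mul hw))
    simpa [mul_add] using this
  have hmem : x ∈ TwoSidedIdeal.jacobson (⊥ : TwoSidedIdeal B) := by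
    rw [TwoSidedIdeal.mem_jacobson_iff]
    intro y
    obtain ⟨c, hc, hu⟩ := exists_unit_add y
    have hv : IsUnit (-algebraMap ℂ B c) := ((IsUnit.mk0 c hc).map (algebraMap ℂ B)).neg
    have h1 := hmul _ _ hu (hmul _ 1 hv isUnit_one)
    have h2 : (y + algebraMap ℂ B c) * x + (-algebraMap ℂ B c * x + 1) = y * x + 1 := by
      noncomm_ring
    rw [h2] at h1
    obtain ⟨u, hu⟩ := h1
    refine ⟨↑u⁻¹, ?_⟩
    have : (↑u⁻¹ : B) * y * x + ↑u⁻¹ - 1 = 0 := by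
      rw [mul_assoc, ← mul_add_one, ← hu]; simp
    rw [this]
    exact TwoSidedIdeal.zero_mem _
  rw [hss] at hmem
  exact (TwoSidedIdeal.mem_bot _).1 hmem

variable {B : Type*} [NormedRing B] [NormedAlgebra ℂ B]

lemma norm_one_add_pow (w : B) (n : ℕ) : ‖(1 + w) ^ n‖ ≤ ‖(1:B)‖ * (1 + ‖w‖) ^ n := by
  induction n with
  | zero => simp
  | succ n ih =>
    rw [pow_succ, mul_add, mul_one]
    refine (norm_add_le _ _).trans ?_
    have := norm_mul_le ((1 + w) ^ n) w
    rw [pow_succ, ← mul_assoc]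
    nlinarith [norm_nonneg w]

noncomputable def PP (x : B) (n : ℕ) : B[X] := (1 + C x * X) ^ n

lemma PP_coeff (x : B) (n k : ℕ) : (PP x n).coeff k = (n.choose k : B) * x ^ k := by
  induction n generalizing k with
  | zero =>
    rcases k with _ | k
    · simp [PP]
    · simp [PP, coeff_one]
  | succ n ih =>
    have : PP x (n + 1) = PP x n + PP x n * C x * X := by
      rw [PP, pow_succ, mul_add, mul_one, ← mul_assoc]; rfl
    rw [this, coeff_add]
    rcases k with _ | k
    · simp [ih]
    · rw [coeff_mul_X, coeff_mul_C, ih, ih, Nat.choose_succ_succ, pow_succ]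
      push_cast
      noncomm_ring

noncomputable def evC (z : ℂ) : B[X] →+* B :=
  eval₂RingHom' (RingHom.id B) (algebraMap ℂ B z) (fun a => (Algebra.commutes z a).symm)

lemma evC_PP (z : ℂ) (x : B) (n : ℕ) : evC z (PP x n) = (1 + z • x) ^ n := by
  rw [PP, map_pow, map_add, map_one, map_mul]
  congr 2
  simp [evC, eval₂RingHom', Algebra.smul_def, Algebra.commutes]

lemma evC_sum (z : ℂ) (P : B[X]) :
    evC z P = ∑ k ∈ Finset.range (P.natDegree + 1), z ^ k • P.coeff k := by
  have : evC z P = P.eval₂ (RingHom.id B) (algebraMap ℂ B z) := rfl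
  rw [this, eval₂_eq_sum_range]
  apply Finset.sum_congr rfl
  intro k _
  rw [← map_pow, Algebra.smul_def, Algebra.commutes]; rfl

variable [CompleteSpace B] {A : Type*} [CStarAlgebra A]

lemma est [Nontrivial A] (τ : A →L[ℂ] ℂ) (hτ1 : τ 1 = 1)
    (htr : ∀ a b : A, τ (a * b) = τ (b * a))
    (hτpos : ∀ a : A, 0 ≤ τ (star a * a))
    (T : B →ₗ[ℂ] A) (hT1 : T 1 = 1) (hTspec : ∀ x : B, spectrum ℂ (T x) = spectrum ℂ x)
    (x y : B) (n : ℕ) (hn : 1 ≤ n) (a : ℕ → A)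
    (hadef : ∀ k, a k = T ((PP ((n : ℂ)⁻¹ • x) n * PP ((n : ℂ)⁻¹ • y) n).coeff k)) :
    ‖2 * τ (a 2) - τ (a 1 * a 1)‖ ≤ 2 * (2 * (3 * Real.log (‖(1:B)‖ + 1) + n * Real.log 4))
        / (n / (‖x‖ + ‖y‖ + 1) / 2) ^ 2 ∧
    ‖6 * τ (a 3) - 6 * τ (a 1 * a 2) + 2 * τ (a 1 * a 1 * a 1)‖
      ≤ 6 * (2 * (3 * Real.log (‖(1:B)‖ + 1) + n * Real.log 4))
        / (n / (‖x‖ + ‖y‖ + 1) / 2) ^ 3 := by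
  set P := PP ((n : ℂ)⁻¹ • x) n * PP ((n : ℂ)⁻¹ • y) n with hP
  set s := ‖x‖ + ‖y‖ + 1 with hs
  have hspos : 0 < s := by positivity
  have hnpos : (0:ℝ) < n := by exact_mod_cast hn
  set K : ℝ := (‖(1:B)‖ + 1) ^ 3 * 4 ^ n with hK
  have hK1 : 1 < K := by
    have h1 : 1 ≤ (‖(1:B)‖ + 1) ^ 3 := one_le_pow₀ (by linarith [norm_nonneg (1:B)])
    have h2 : (1:ℝ) < 4 ^ n := one_lt_pow₀ (by norm_num) (by omega)
    nlinarith
  have hlogK : Real.log K = 3 * Real.log (‖(1:B)‖ + 1) + n * Real.log 4 := by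
    rw [hK, Real.log_mul (by positivity) (by positivity), Real.log_pow, Real.log_pow]
    norm_num
  rw [← hlogK]
  have hev : ∀ z, polyE (P.natDegree + 1) a z = T (evC z P) := by
    intro z
    rw [evC_sum, map_sum]
    simp [polyE, hadef]
  have hev2 : ∀ z, evC z P = (1 + z • (n:ℂ)⁻¹ • x) ^ n * (1 + z • (n:ℂ)⁻¹ • y) ^ n := by
    intro z
    rw [hP, map_mul, evC_PP, evC_PP]
  have hsmall : ∀ z ∈ Metric.ball (0:ℂ) (n / s), ∀ w : B, ‖w‖ < s → ‖z • (n:ℂ)⁻¹ • w‖ < 1 := by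
    intro z hz w hw
    rw [mem_ball_zero_iff, lt_div_iff₀ hspos] at hz
    rw [norm_smul, norm_smul, norm_inv, Complex.norm_natCast]
    rw [show ‖z‖ * ((n:ℝ)⁻¹ * ‖w‖) = (‖z‖ * ‖w‖) / n by field_simp, div_lt_one hnpos]
    nlinarith [norm_nonneg z]
  have hxs : ‖x‖ < s := by rw [hs]; linarith [norm_nonneg y]
  have hys : ‖y‖ < s := by rw [hs]; linarith [norm_nonneg x]
  have hunit : ∀ w : B, ‖w‖ < 1 → IsUnit (1 + w) := by
    intro w hw
    have := isUnit_one_sub_of_norm_lt_one (x := -w) (by simpa using hw)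
    simpa using this
  apply coef_bound τ hτ1 htr hτpos (P.natDegree + 1) a _ _ (n / s) K (by positivity) hK1
  · intro z hz
    rw [hev, ← spectrum.zero_notMem_iff ℂ, hTspec, spectrum.zero_notMem_iff, hev2]
    exact ((hunit _ (hsmall z hz x hxs)).pow n).mul ((hunit _ (hsmall z hz y hys)).pow n)
  · intro z hz
    rw [hev, spectralRadius, hTspec]
    refine lt_of_le_of_lt (b := ENNReal.ofReal (‖(1:B)‖ ^ 3 * 4 ^ n)) ?_ ?_
    · refine iSup₂_le fun k hk => ?_
      have h1 := spectrum.norm_le_norm_mul_of_mem hk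
      have hb : ∀ w : B, ‖w‖ < s → ‖(1 + z • (n:ℂ)⁻¹ • w) ^ n‖ ≤ ‖(1:B)‖ * 2 ^ n := by
        intro w hw
        refine (norm_one_add_pow _ n).trans ?_
        gcongr
        linarith [hsmall z hz w hw]
      have h2 : ‖evC z P‖ ≤ (‖(1:B)‖ * 2 ^ n) * (‖(1:B)‖ * 2 ^ n) := by
        rw [hev2]
        refine (norm_mul_le _ _).trans ?_
        gcongr
        · exact hb x hxs
        · exact hb y hys
      change ‖k‖ₑ ≤ _
      rw [← ofReal_norm]
      apply ENNReal.ofReal_le_ofReal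
      refine h1.trans ((mul_le_mul_of_nonneg_right h2 (norm_nonneg _)).trans (le_of_eq ?_))
      rw [show (4:ℝ) = 2 * 2 by norm_num, mul_pow]
      ring
    · apply (ENNReal.ofReal_lt_ofReal_iff (by linarith)).2
      rw [hK]
      gcongr
      linarith
  · intro k hk
    rw [hadef, coeff_eq_zero_of_natDegree_lt (by omega), map_zero]
  · rw [hadef, hP, mul_coeff_zero, PP_coeff, PP_coeff]
    simp [hT1]

end banach

section final
open Polynomial Filter Topology

noncomputable def cc2 (n : ℕ) : ℂ := (n.choose 2 : ℂ) * (n : ℂ)⁻¹ ^ 2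
noncomputable def cc3 (n : ℕ) : ℂ := (n.choose 3 : ℂ) * (n : ℂ)⁻¹ ^ 3

lemma choose3 (n : ℕ) : (n.choose 3 : ℂ) = n * (n - 1) * (n - 2) / 6 := by
  induction n with
  | zero => simp
  | succ n ih =>
    rw [Nat.choose_succ_succ]
    push_cast
    rw [ih, Nat.cast_choose_two]
    ring

lemma inv_lim : Tendsto (fun n : ℕ => (n : ℂ)⁻¹) atTop (𝓝 0) := tendsto_inv_atTop_nhds_zero_nat

lemma cc2_lim : Tendsto cc2 atTop (𝓝 (1 / 2)) := by
  have h : Tendsto (fun n : ℕ => (1 - (n : ℂ)⁻¹) / 2) atTop (𝓝 ((1 - 0) / 2)) :=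
    (inv_lim.const_sub 1).div_const 2
  rw [sub_zero] at h
  refine h.congr' ?_
  filter_upwards [eventually_ge_atTop 1] with n hn
  have : (n : ℂ) ≠ 0 := by exact_mod_cast (by omega : n ≠ 0)
  rw [cc2, Nat.cast_choose_two]
  field_simp

lemma cc3_lim : Tendsto cc3 atTop (𝓝 (1 / 6)) := by
  have h : Tendsto (fun n : ℕ => (1 - (n : ℂ)⁻¹) * (1 - 2 * (n : ℂ)⁻¹) / 6) atTop
      (𝓝 ((1 - 0) * (1 - 2 * 0) / 6)) :=
    ((inv_lim.const_sub 1).mul ((inv_lim.const_mul 2).const_sub 1)).div_const 6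
  rw [mul_zero, sub_zero, one_mul] at h
  refine h.congr' ?_
  filter_upwards [eventually_ge_atTop 1] with n hn
  have : (n : ℂ) ≠ 0 := by exact_mod_cast (by omega : n ≠ 0)
  rw [cc3, choose3]
  field_simp

lemma bound_lim (d c0 c1 s : ℝ) (hs : 0 < s) (k : ℕ) (hk : 2 ≤ k) :
    Tendsto (fun n : ℕ => d * (2 * (c0 + n * c1)) / (n / s / 2) ^ k) atTop (𝓝 0) := by
  have hi : Tendsto (fun n : ℕ => (n : ℝ)⁻¹) atTop (𝓝 0) := tendsto_inv_atTop_nhds_zero_nat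
  obtain ⟨j, rfl⟩ : ∃ j, k = j + 1 + 1 := ⟨k - 2, by omega⟩
  have h : Tendsto (fun n : ℕ => d * 2 * (2 * s) ^ (j + 1 + 1) *
      ((c0 * (n : ℝ)⁻¹ + c1) * ((n : ℝ)⁻¹ ^ (j + 1)))) atTop
      (𝓝 (d * 2 * (2 * s) ^ (j + 1 + 1) * ((c0 * 0 + c1) * (0 ^ (j + 1))))) :=
    (((hi.const_mul c0).add_const c1).mul (hi.pow (j + 1))).const_mul _
  simp only [ne_eq, Nat.add_eq_zero_iff, one_ne_zero, and_false, not_false_eq_true, zero_pow,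
    mul_zero] at h
  refine h.congr' ?_
  filter_upwards [eventually_ge_atTop 1] with n hn
  have hnpos : (0:ℝ) < n := by exact_mod_cast hn
  rw [div_pow, div_pow, inv_pow]
  field_simp
  rw [mul_pow]
  ring

variable {B : Type*} [NormedRing B] [NormedAlgebra ℂ B]

lemma coeff1 (x y : B) (n : ℕ) (hn : 1 ≤ n) :
    (PP ((n : ℂ)⁻¹ • x) n * PP ((n : ℂ)⁻¹ • y) n).coeff 1 = x + y := by
  have : (n : ℂ) ≠ 0 := by exact_mod_cast (by omega : n ≠ 0)
  have hc : ∀ w : B, (n : B) * (n : ℂ)⁻¹ • w = w := by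
    intro w
    rw [← nsmul_eq_mul, ← Nat.cast_smul_eq_nsmul ℂ, smul_smul, mul_inv_cancel₀ this, one_smul]
  rw [coeff_mul, Finset.Nat.sum_antidiagonal_eq_sum_range_succ_mk]
  simp [Finset.sum_range_succ, PP_coeff, hc, add_comm]

lemma chooseterm (x : B) (n k : ℕ) :
    (n.choose k : B) * ((n : ℂ)⁻¹ • x) ^ k = ((n.choose k : ℂ) * (n : ℂ)⁻¹ ^ k) • x ^ k := by
  rw [← nsmul_eq_mul, ← Nat.cast_smul_eq_nsmul ℂ, _root_.smul_pow, smul_smul]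

lemma coeff2 (x y : B) (n : ℕ) (hn : 1 ≤ n) :
    (PP ((n : ℂ)⁻¹ • x) n * PP ((n : ℂ)⁻¹ • y) n).coeff 2
      = cc2 n • (x * x + y * y) + x * y := by
  have : (n : ℂ) ≠ 0 := by exact_mod_cast (by omega : n ≠ 0)
  rw [coeff_mul, Finset.Nat.sum_antidiagonal_eq_sum_range_succ_mk]
  simp only [Finset.sum_range_succ, PP_coeff, chooseterm, cc2]
  simp [this, sq]
  abel

lemma coeff3 (x : B) (n : ℕ) :
    (PP ((n : ℂ)⁻¹ • x) n * PP ((n : ℂ)⁻¹ • (0:B)) n).coeff 3 = cc3 n • (x * x * x) := by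
  have : PP ((n : ℂ)⁻¹ • (0:B)) n = 1 := by simp [PP]
  rw [this, mul_one, PP_coeff, chooseterm, cc3]
  congr 1
  rw [pow_succ, sq]

variable [CompleteSpace B] {A : Type*} [CStarAlgebra A]

lemma second_order [Nontrivial A] (τ : A →L[ℂ] ℂ) (hτ1 : τ 1 = 1)
    (htr : ∀ a b : A, τ (a * b) = τ (b * a))
    (hτpos : ∀ a : A, 0 ≤ τ (star a * a))
    (T : B →ₗ[ℂ] A) (hT1 : T 1 = 1) (hTspec : ∀ x : B, spectrum ℂ (T x) = spectrum ℂ x)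
    (x y : B) : τ (T (x * x)) + τ (T (y * y)) + 2 * τ (T (x * y)) =
      τ ((T x + T y) * (T x + T y)) := by
  have hle : ∀ᶠ n : ℕ in atTop,
      ‖2 * (cc2 n * (τ (T (x * x)) + τ (T (y * y))) + τ (T (x * y)))
        - τ ((T x + T y) * (T x + T y))‖ ≤
      2 * (2 * (3 * Real.log (‖(1:B)‖ + 1) + n * Real.log 4)) / (n / (‖x‖ + ‖y‖ + 1) / 2) ^ 2 := by
    filter_upwards [eventually_ge_atTop 1] with n hn
    have := (est τ hτ1 htr hτpos T hT1 hTspec x y n hn _ (fun _ => rfl)).1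
    simpa only [coeff1 x y n hn, coeff2 x y n hn, map_add, map_smul, smul_eq_mul] using this
  have h0 := squeeze_zero_norm' hle (bound_lim 2 _ _ (‖x‖ + ‖y‖ + 1) (by positivity) 2 le_rfl)
  have h1 : Tendsto (fun n : ℕ => 2 * (cc2 n * (τ (T (x * x)) + τ (T (y * y))) + τ (T (x * y)))
        - τ ((T x + T y) * (T x + T y))) atTop
      (𝓝 (2 * (1 / 2 * (τ (T (x * x)) + τ (T (y * y))) + τ (T (x * y)))
        - τ ((T x + T y) * (T x + T y)))) :=
    (((cc2_lim.mul_const _).add_const _).const_mul 2).sub_const _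
  have := tendsto_nhds_unique h1 h0
  linear_combination this

lemma third_order [Nontrivial A] (τ : A →L[ℂ] ℂ) (hτ1 : τ 1 = 1)
    (htr : ∀ a b : A, τ (a * b) = τ (b * a))
    (hτpos : ∀ a : A, 0 ≤ τ (star a * a))
    (T : B →ₗ[ℂ] A) (hT1 : T 1 = 1) (hTspec : ∀ x : B, spectrum ℂ (T x) = spectrum ℂ x)
    (x : B) : τ (T (x * x * x)) - 3 * τ (T x * T (x * x)) + 2 * τ (T x * T x * T x) = 0 := by
  have hle : ∀ᶠ n : ℕ in atTop,
      ‖6 * (cc3 n * τ (T (x * x * x))) - 6 * (cc2 n * τ (T x * T (x * x)))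
        + 2 * τ (T x * T x * T x)‖ ≤
      6 * (2 * (3 * Real.log (‖(1:B)‖ + 1) + n * Real.log 4)) / (n / (‖x‖ + ‖(0:B)‖ + 1) / 2) ^ 3 := by
    filter_upwards [eventually_ge_atTop 1] with n hn
    have := (est τ hτ1 htr hτpos T hT1 hTspec x 0 n hn _ (fun _ => rfl)).2
    simpa only [coeff1 x 0 n hn, coeff2 x 0 n hn, coeff3, map_add, map_smul, smul_eq_mul, mul_zero,
      add_zero, mul_smul_comm] using this
  have h0 := squeeze_zero_norm' hle
    (bound_lim 6 _ _ (‖x‖ + ‖(0:B)‖ + 1) (by positivity) 3 (by norm_num))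
  have h1 : Tendsto (fun n : ℕ => 6 * (cc3 n * τ (T (x * x * x)))
        - 6 * (cc2 n * τ (T x * T (x * x))) + 2 * τ (T x * T x * T x)) atTop
      (𝓝 (6 * (1 / 6 * τ (T (x * x * x)))
        - 6 * (1 / 2 * τ (T x * T (x * x))) + 2 * τ (T x * T x * T x))) :=
    (((cc3_lim.mul_const _).const_mul 6).sub ((cc2_lim.mul_const _).const_mul 6)).add_const _
  have := tendsto_nhds_unique h1 h0
  linear_combination this

lemma jordan_core [Nontrivial A] (τ : A →L[ℂ] ℂ) (hτ1 : τ 1 = 1)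
    (htr : ∀ a b : A, τ (a * b) = τ (b * a))
    (hτpos : ∀ a : A, 0 ≤ τ (star a * a))
    (T : B →ₗ[ℂ] A) (hT1 : T 1 = 1) (hTspec : ∀ x : B, spectrum ℂ (T x) = spectrum ℂ x)
    (x z : B) : τ (T z * (T (x * x) - T x * T x)) = 0 := by
  have so := second_order τ hτ1 htr hτpos T hT1 hTspec
  have hsq : ∀ x, τ (T (x * x)) = τ (T x * T x) := by
    intro x
    have := so x 0
    simpa using this
  -- multiplicativity of the trace form
  have hmul : ∀ x y, τ (T (x * y)) = τ (T x * T y) := by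
    intro x y
    have h1 := so x y
    have h2 := htr (T y) (T x)
    simp only [mul_add, add_mul, map_add, h2] at h1
    linear_combination (1/2) * h1 - (1/2) * hsq x - (1/2) * hsq y
  have h3 : ∀ x, τ (T x * T (x * x)) = τ (T x * T x * T x) := by
    intro x
    have h1 := third_order τ hτ1 htr hτpos T hT1 hTspec x
    have h2 := hmul x (x * x)
    rw [← mul_assoc] at h2
    linear_combination (-1/2) * h1 + (1/2) * h2
  have hp := h3 (x + z)
  have hm := h3 (x - z)
  have hz := h3 z
  have c1 : ∀ a b c : B, τ (T a * (T b * T c)) = τ (T b * (T c * T a)) := by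
    intro a b c
    rw [htr, mul_assoc]
  have e1 := hmul x (x * z)
  have e2 := hmul x (z * x)
  have e3 := hmul z (x * x)
  have e4 := htr (T x) (T (z * x))
  have e5 := hmul (z * x) x
  have e6 := hmul (x * x) z
  have e7 := htr (T (x * x)) (T z)
  have e8 := htr (T x) (T (x * z))
  simp only [mul_assoc] at e1 e2 e3 e5 e6
  simp only [map_add, map_sub, mul_add, add_mul, mul_sub, sub_mul, mul_assoc] at hp hm hz ⊢
  have f1 := c1 x x z
  have f2 := c1 x z x
  have f3 := c1 z x x
  linear_combination (1/6) * (hp - hm) - (1/3) * hz + (1/3) * f2 - (1/3) * f3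
    - (1/3) * (e4 - e5 + e3) - (1/3) * (-e1 + e6 + e7)

end final

end SpecJordan

/-- A surjective spectrum-preserving linear mapping between two semisimple unital
complex Banach algebras, one of which is a unital C*-algebra equipped with a faithful
tracial state, is a Jordan isomorphism.  (Here the C*-algebra is taken to be the
codomain; the other case follows by symmetry since such a map is bijective with
spectrum-preserving inverse.) -/
theorem jordan_iso_of_spectrum_preserving
    {B A : Type*} [NormedRing B] [NormedAlgebra ℂ B] [CompleteSpace B]
    [CStarAlgebra A]
    (hBss : TwoSidedIdeal.jacobson (⊥ : TwoSidedIdeal B) = ⊥)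
    (hAss : TwoSidedIdeal.jacobson (⊥ : TwoSidedIdeal A) = ⊥)
    (τ : A →ₗ[ℂ] ℂ)
    (hτ1 : τ 1 = 1)
    (hτtrace : ∀ a b : A, τ (a * b) = τ (b * a))
    (hτpos : ∀ a : A, 0 ≤ τ (star a * a))
    (hτfaithful : ∀ a : A, τ (star a * a) = 0 → a = 0)
    (T : B →ₗ[ℂ] A)
    (hTsurj : Function.Surjective T)
    (hTspec : ∀ x : B, spectrum ℂ (T x) = spectrum ℂ x) :
    Function.Bijective T ∧ ∀ a : B, T (a * a) = T a * T a := by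
  have hnt : Nontrivial A := by
    refine ⟨⟨1, 0, fun h => ?_⟩⟩
    rw [h, map_zero] at hτ1
    exact zero_ne_one hτ1
  have hinj : Function.Injective T := by
    rw [injective_iff_map_eq_zero]
    intro x hx
    apply SpecJordan.rad_zero hBss
    intro u hu
    rw [← spectrum.zero_notMem_iff ℂ] at hu ⊢
    rwa [← hTspec, map_add, hx, zero_add, hTspec]
  have hT1 : T 1 = 1 := by
    rw [← sub_eq_zero]
    apply SpecJordan.rad_zero hAss
    intro u hu
    obtain ⟨y, hy⟩ := hTsurj (u - 1)
    have h1 : T 1 - 1 + u = T (1 + y) := by rw [map_add, hy]; abel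
    have h2 : (1 : B) + y = algebraMap ℂ B 1 + y := by simp
    have h3 : u = algebraMap ℂ A 1 + T y := by simp [hy]
    rw [← spectrum.zero_notMem_iff ℂ] at hu ⊢
    rw [h1, hTspec, h2, ← spectrum.singleton_add_eq, ← hTspec, spectrum.singleton_add_eq, ← h3]
    exact hu
  refine ⟨⟨hinj, hTsurj⟩, fun x => ?_⟩
  rw [← sub_eq_zero]
  apply hτfaithful
  obtain ⟨z, hz⟩ := hTsurj (star (T (x * x) - T x * T x))
  have := SpecJordan.jordan_core ⟨τ, SpecJordan.tau_cont τ hτpos⟩ hτ1 hτtrace hτpos T hT1 hTspec x z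
  rw [hz] at this
  exact this
end

section
/- Let A be a simple unital C*-algebra (A has no proper nonzero closed two-sided ideals) which carries a tracial state, let B be a unital complex Banach algebra, and let T : B → A be a surjective unital linear mapping which preserves invertible elements. Then T is a Jordan homomorphism, i.e., T(a²) = (T a)² for every a ∈ B. -/
open scoped ComplexOrder

namespace JordanAux

theorem cauchy_schwarz {A : Type*} [CStarAlgebra A] [PartialOrder A] [StarOrderedRing A]
    (f : A →ₚ[ℂ] ℂ) (a b : A) :
    ‖f (star a * b)‖ ≤ √(f (star a * a)).re * √(f (star b * b)).re := by
  have := norm_inner_le_norm (𝕜 := ℂ) (f.toPreGNS a) (f.toPreGNS b)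
  simpa [PositiveLinearMap.preGNS_inner_def, PositiveLinearMap.preGNS_norm_def] using this

theorem norm_trace_le_one {A : Type*} [CStarAlgebra A] [PartialOrder A] [StarOrderedRing A]
    (f : A →ₚ[ℂ] ℂ) (hf1 : f 1 = 1) (hf : ∀ a b : A, f (a * b) = f (b * a))
    (a : A) (N : ℕ) (hN : 0 < N) (ha : ‖a ^ N‖ ≤ 1) : ‖f a‖ ≤ 1 := by
  set p : A := ∑ n ∈ Finset.range N, star (a ^ n) * a ^ n with hp
  have hp1 : 1 ≤ p := by
    obtain ⟨M, rfl⟩ : ∃ M, N = M + 1 := ⟨N - 1, by omega⟩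
    rw [hp, Finset.sum_range_succ']
    simp only [pow_zero, star_one, mul_one]
    exact le_add_of_nonneg_left (Finset.sum_nonneg fun i _ => star_mul_self_nonneg _)
  have hlast : star (a ^ N) * a ^ N ≤ 1 := by
    have h1 : ‖star (a ^ N) * a ^ N‖ ≤ 1 := by
      rw [CStarRing.norm_star_mul_self]
      nlinarith [norm_nonneg (a ^ N)]
    exact (CStarAlgebra.norm_le_one_iff_of_nonneg _ (star_mul_self_nonneg _)).1 h1
  have hpa : star a * p * a ≤ p := by
    have h2 : star a * p * a = ∑ n ∈ Finset.range N, star (a ^ (n+1)) * a ^ (n+1) := by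
      rw [hp, Finset.mul_sum, Finset.sum_mul]
      refine Finset.sum_congr rfl fun n _ => ?_
      simp only [pow_succ, star_mul, mul_assoc]
    have h3 := Finset.sum_range_succ (fun n => star (a ^ n) * a ^ n) N
    rw [Finset.sum_range_succ'] at h3
    simp only [pow_zero, star_one, mul_one] at h3
    rw [← h2, ← hp] at h3
    have h4 : star a * p * a + 1 ≤ p + 1 := by rw [h3]; gcongr
    exact le_of_add_le_add_right h4
  have hp0 : 0 ≤ p := zero_le_one.trans hp1
  have hpu : IsUnit p := CStarAlgebra.isUnit_of_le 1 hp1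
  obtain ⟨u, hu⟩ := (CFC.isUnit_sqrt_iff p hp0).2 hpu
  have hus : star (u : A) = u := by rw [hu]; exact (CFC.sqrt_nonneg p).star_eq
  have huu : (u : A) * u = p := by rw [hu]; exact CFC.sqrt_mul_sqrt_self p hp0
  have hvs : star (↑u⁻¹ : A) = ↑u⁻¹ := by
    have h5 : star u = u := Units.ext hus
    rw [← Units.coe_star_inv, h5]
  have hfa : f a = f (star (1 : A) * (u * a * ↑u⁻¹)) := by
    rw [star_one, one_mul, hf, ← mul_assoc]; simp
  have key : f (star (u * a * (↑u⁻¹ : A)) * (u * a * ↑u⁻¹)) ≤ 1 := by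
    have e : star (u * a * (↑u⁻¹ : A)) * (u * a * ↑u⁻¹) =
        star (↑u⁻¹ : A) * (star a * p * a) * ↑u⁻¹ := by
      rw [← huu]; simp only [star_mul, hus, mul_assoc]
    rw [e, ← hf1]
    have h6 := star_left_conjugate_le_conjugate hpa (↑u⁻¹ : A)
    have h7 : star (↑u⁻¹ : A) * p * ↑u⁻¹ = 1 := by
      rw [hvs, ← huu]; simp [← mul_assoc]
    rw [h7] at h6
    exact OrderHomClass.mono f h6
  have := cauchy_schwarz f 1 (u * a * (↑u⁻¹ : A))
  rw [← hfa] at this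
  refine this.trans ?_
  simp only [star_one, one_mul, hf1, Complex.one_re, Real.sqrt_one]
  exact Real.sqrt_le_one.2 (by simpa using (Complex.le_def.1 key).1)

theorem norm_trace_map_le {B A : Type*} [NormedRing B] [NormedAlgebra ℂ B] [CompleteSpace B]
    [CStarAlgebra A] [PartialOrder A] [StarOrderedRing A]
    (f : A →ₚ[ℂ] ℂ) (hf1 : f 1 = 1) (hf : ∀ a b : A, f (a * b) = f (b * a))
    (T : B →ₗ[ℂ] A) (hT1 : T 1 = 1) (hTinv : ∀ x : B, IsUnit x → IsUnit (T x))
    (x : B) (hx : ‖x‖ < 1) : ‖f (T x)‖ ≤ 1 := by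
  have hr : spectralRadius ℂ (T x) < 1 := by
    have : spectralRadius ℂ (T x) ≤ (‖x‖₊ : ENNReal) := by
      refine iSup₂_le fun k hk => ?_
      by_contra! hlt
      have hlt' : ‖x‖ < ‖k‖ := by exact_mod_cast hlt
      have hk0 : k ≠ 0 := by
        rintro rfl; simp at hlt'; linarith [norm_nonneg x]
      have h1 : IsUnit (1 - k⁻¹ • x) := by
        apply isUnit_one_sub_of_norm_lt_one
        rw [norm_smul, norm_inv, inv_mul_lt_iff₀ (norm_pos_iff.2 hk0)]
        simpa using hlt'
      have h2 := (IsUnit.mk0 k hk0).map (algebraMap ℂ A) |>.mul (hTinv _ h1)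
      apply hk
      rw [spectrum.mem_resolventSet_iff]
      convert h2 using 1
      simp [hT1, mul_sub, Algebra.algebraMap_eq_smul_one, smul_smul, hk0]
    refine this.trans_lt ?_
    exact_mod_cast hx
  have h := spectrum.pow_nnnorm_pow_one_div_tendsto_nhds_spectralRadius (T x)
  obtain ⟨N, hN, hN0⟩ := ((h.eventually_lt_const hr).and (Filter.eventually_gt_atTop 0)).exists
  refine norm_trace_le_one f hf1 hf _ N hN0 ?_
  by_contra! hc
  have h3 : (1 : ENNReal) ≤ (‖T x ^ N‖₊ : ENNReal) := by exact_mod_cast hc.le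
  exact absurd hN (not_lt.2 (ENNReal.one_le_rpow h3 (by positivity)))

/-- The bilinear defect vanishes. -/
theorem trace_mul {B A : Type*} [NormedRing B] [NormedAlgebra ℂ B] [CompleteSpace B]
    [CStarAlgebra A] [PartialOrder A] [StarOrderedRing A]
    (f : A →ₚ[ℂ] ℂ) (hf1 : f 1 = 1) (hf : ∀ a b : A, f (a * b) = f (b * a))
    (T : B →ₗ[ℂ] A) (hT1 : T 1 = 1) (hTinv : ∀ x : B, IsUnit x → IsUnit (T x))
    (z x : B) : f (T (z * x)) = f (T z * T x) := by
  wlog hx : ‖x‖ < 1 generalizing x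
  · obtain ⟨c, hc⟩ : ∃ c : ℝ, c = (‖x‖ + 1)⁻¹ := ⟨_, rfl⟩
    have hc0 : 0 < c := by rw [hc]; positivity
    have := this ((c : ℂ) • x) (by
      rw [norm_smul, Complex.norm_real, Real.norm_of_nonneg hc0.le, hc, inv_mul_lt_iff₀ (by positivity)]
      linarith)
    simp only [mul_smul_comm, map_smul] at this
    have hc' : (c : ℂ) ≠ 0 := by exact_mod_cast hc0.ne'
    exact smul_right_injective _ hc' this
  have expand : ∀ (n : ℕ) (y : B) , ∃ P : ℂ → A, (∀ m, P m = T ((1 + m • z) ^ n * y)) ∧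
      Differentiable ℂ P ∧ HasDerivAt P ((n : ℂ) • T (z * y)) 0 := by
    intro n
    induction n with
    | zero => 
      intro y
      refine ⟨fun _ => T y, by simp, by fun_prop, by simpa using hasDerivAt_const _ _⟩
    | succ n ih =>
      intro y
      obtain ⟨P, hP, hPd, hP'⟩ := ih y
      obtain ⟨Q, hQ, hQd, hQ'⟩ := ih (z * y)
      refine ⟨fun m => P m + m • Q m, fun m => ?_, by fun_prop, ?_⟩
      · change P m + m • Q m = _
        rw [hP, hQ, ← map_smul, ← map_add]
        congr 1
        rw [pow_succ, mul_assoc]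
        simp [add_mul, mul_add]
      · have := hP'.add ((hasDerivAt_id (0:ℂ)).smul hQ')
        have hQ0 : Q 0 = T (z * y) := by simp [hQ]
        refine this.congr_deriv ?_
        simp [hQ0, add_smul]
  have fc : Continuous f := map_continuous f
  let F : A →L[ℂ] ℂ := ⟨f.toLinearMap, fc⟩
  have hF : ∀ a, F a = f a := fun a => rfl
  set R : ℝ := (‖z‖ + 1)⁻¹ / 2 with hR
  have hR0 : 0 < R := by positivity
  have hunit : ∀ m : ℂ, m ∈ Metric.closedBall (0:ℂ) R → ∀ n : ℕ, IsUnit ((1 + m • z) ^ n) := by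
    intro m hm n
    apply IsUnit.pow
    have := isUnit_one_sub_of_norm_lt_one (x := -(m • z)) (by
      rw [norm_neg, norm_smul]
      have h1 : ‖m‖ ≤ R := by simpa using hm
      have h2 : ‖m‖ * ‖z‖ ≤ R * (‖z‖ + 1) := by gcongr; linarith
      have h3 : R * (‖z‖ + 1) = 1 / 2 := by rw [hR]; field_simp
      linarith)
    simpa using this
  have bound : ∀ n : ℕ, (n : ℝ) * ‖f (T (z * x)) - f (T z * T x)‖ ≤ 1 / R := by
    intro n
    obtain ⟨P, hP, hPd, hP'⟩ := expand n 1
    obtain ⟨Q, hQ, hQd, hQ'⟩ := expand n x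
    simp only [mul_one] at hP hP'
    have hP0 : P 0 = 1 := by simp [hP, hT1]
    have hQ0 : Q 0 = T x := by simp [hQ]
    have hu : ∀ m ∈ Metric.closedBall (0:ℂ) R, IsUnit (P m) := fun m hm => by
      rw [hP]; exact hTinv _ (hunit m hm n)
    have hGd : ∀ m ∈ Metric.closedBall (0:ℂ) R,
        DifferentiableAt ℂ (fun m => F (Ring.inverse (P m) * Q m)) m := fun m hm =>
      F.differentiableAt.comp m (((hPd m).inverse (hu m hm)).mul (hQd m))
    have hder : HasDerivAt (fun m => F (Ring.inverse (P m) * Q m))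
        (F (-((n : ℂ) • T z) * T x + (n : ℂ) • T (z * x))) 0 := by
      have hi : HasDerivAt (fun m => Ring.inverse (P m)) (-((n : ℂ) • T z)) 0 := by
        have h1 := hasFDerivAt_ringInverse (𝕜 := ℂ) (1 : Aˣ)
        rw [Units.val_one, ← hP0] at h1
        have := h1.comp_hasDerivAt 0 hP'
        exact this.congr_deriv (by simp)
      have := F.hasFDerivAt.comp_hasDerivAt 0 (hi.mul hQ')
      exact this.congr_deriv (by simp [hP0, hQ0])
    have hb : ∀ m ∈ Metric.sphere (0:ℂ) R, ‖F (Ring.inverse (P m) * Q m)‖ ≤ 1 := by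
      intro m hm
      have hm' := Metric.sphere_subset_closedBall hm
      let S : B →ₗ[ℂ] A := (LinearMap.mulLeft ℂ (Ring.inverse (P m))) ∘ₗ T ∘ₗ
        (LinearMap.mulLeft ℂ ((1 + m • z) ^ n))
      have hS : ∀ y, S y = Ring.inverse (P m) * T ((1 + m • z) ^ n * y) := fun y => rfl
      have := norm_trace_map_le f hf1 hf S (by
        rw [hS, mul_one, ← hP]; exact Ring.inverse_mul_cancel _ (hu m hm'))
        (fun y hy => by
          rw [hS]
          exact (isUnit_ringInverse.2 (hu m hm')).mul (hTinv _ ((hunit m hm' n).mul hy))) x hx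
      rw [hS, ← hQ] at this
      exact this
    have hdc : DiffContOnCl ℂ (fun m => F (Ring.inverse (P m) * Q m)) (Metric.ball 0 R) := by
      apply DifferentiableOn.diffContOnCl
      intro m hm
      exact (hGd m (Metric.closure_ball_subset_closedBall hm)).differentiableWithinAt
    have := Complex.norm_deriv_le_of_forall_mem_sphere_norm_le hR0 hdc hb
    rw [hder.deriv] at this
    have e : F (-((n : ℂ) • T z) * T x + (n : ℂ) • T (z * x)) =
        (n : ℂ) * (f (T (z * x)) - f (T z * T x)) := by
      simp only [map_add, neg_mul, map_neg, smul_mul_assoc, map_smul, hF, smul_eq_mul]; ring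
    rw [e, norm_mul, Complex.norm_natCast] at this
    exact this
  by_contra hne
  have hpos : 0 < ‖f (T (z * x)) - f (T z * T x)‖ := norm_pos_iff.2 (sub_ne_zero.2 hne)
  obtain ⟨n, hn⟩ := exists_nat_gt ((1 / R) / ‖f (T (z * x)) - f (T z * T x)‖)
  rw [div_lt_iff₀ hpos] at hn
  linarith [bound n]

/-- The trilinear identity. -/
theorem trace_mul_mul {B A : Type*} [NormedRing B] [NormedAlgebra ℂ B] [CompleteSpace B]
    [CStarAlgebra A] [PartialOrder A] [StarOrderedRing A]
    (f : A →ₚ[ℂ] ℂ) (hf1 : f 1 = 1) (hf : ∀ a b : A, f (a * b) = f (b * a))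
    (T : B →ₗ[ℂ] A) (hT1 : T 1 = 1) (hTinv : ∀ x : B, IsUnit x → IsUnit (T x))
    (z x : B) : f (T z * T z * T x) = f (T (z * z) * T x) := by
  have fc : Continuous f := map_continuous f
  let F : A →L[ℂ] ℂ := ⟨f.toLinearMap, fc⟩
  have hF : ∀ a, F a = f a := fun a => rfl
  let I : ℂ → A := fun m => Ring.inverse (1 + m • T z)
  have hder : ∀ y : B, HasDerivAt (fun m : ℂ => I m * (T y + m • T (z * y)))
      (T (z * y) - T z * T y) 0 := by
    intro y
    have hlin : ∀ a b : A, HasDerivAt (fun m : ℂ => a + m • b) b 0 := fun a b => by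
      simpa using ((hasDerivAt_id (0:ℂ)).smul_const b).const_add a
    have hi : HasDerivAt I (-T z) 0 := by
      have h1 := hasFDerivAt_ringInverse (𝕜 := ℂ) (1 : Aˣ)
      have e : ((1 : Aˣ) : A) = 1 + (0:ℂ) • T z := by simp
      rw [e] at h1
      have := h1.comp_hasDerivAt 0 (hlin 1 (T z))
      exact this.congr_deriv (by simp)
    have := hi.mul (hlin (T y) (T (z * y)))
    exact this.congr_deriv (by simp [I]; abel)
  have h0 : ∀ y : B, I 0 * (T y + (0:ℂ) • T (z * y)) = T y := by intro y; simp [I]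
  have hL : HasDerivAt (fun m : ℂ => F (I m * (T (z * x) + m • T (z * (z * x)))))
      (F (T (z * (z * x)) - T z * T (z * x))) 0 :=
    F.hasFDerivAt.comp_hasDerivAt 0 (hder (z * x))
  have hRt : HasDerivAt
      (fun m : ℂ => F ((I m * (T z + m • T (z * z))) * (I m * (T x + m • T (z * x)))))
      (F ((T (z * z) - T z * T z) * T x + T z * (T (z * x) - T z * T x))) 0 := by
    have := F.hasFDerivAt.comp_hasDerivAt 0 ((hder z).mul (hder x))
    rw [h0, h0] at this
    exact this
  have hev : (fun m : ℂ => F (I m * (T (z * x) + m • T (z * (z * x))))) =ᶠ[nhds 0]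
      (fun m : ℂ => F ((I m * (T z + m • T (z * z))) * (I m * (T x + m • T (z * x))))) := by
    have hc : Filter.Tendsto (fun m : ℂ => ‖-(m • z)‖) (nhds 0) (nhds 0) := by
      have : Continuous (fun m : ℂ => ‖-(m • z)‖) := by fun_prop
      simpa using this.tendsto 0
    filter_upwards [hc.eventually_lt_const one_pos] with m hm
    have hu : IsUnit (1 + m • z) := by simpa using isUnit_one_sub_of_norm_lt_one hm
    have hTb : T (1 + m • z) = 1 + m • T z := by simp [hT1]
    have hTu : IsUnit (1 + m • T z) := hTb ▸ hTinv _ hu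
    let S : B →ₗ[ℂ] A := (LinearMap.mulLeft ℂ (I m)) ∘ₗ T ∘ₗ (LinearMap.mulLeft ℂ (1 + m • z))
    have hS : ∀ y, S y = I m * T ((1 + m • z) * y) := fun y => rfl
    have hS' : ∀ y, S y = I m * (T y + m • T (z * y)) := fun y => by
      rw [hS]; simp [add_mul]
    have := trace_mul f hf1 hf S (by
        rw [hS, mul_one, hTb]; exact Ring.inverse_mul_cancel _ hTu)
        (fun y hy => by
          rw [hS]
          exact (isUnit_ringInverse.2 hTu).mul (hTinv _ (hu.mul hy))) z x
    rw [hS', hS', hS'] at this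
    exact this
  have heq := (hL.congr_of_eventuallyEq hev.symm).unique hRt
  have tm := trace_mul f hf1 hf T hT1 hTinv
  simp only [hF, map_sub, map_add, sub_mul, mul_sub] at heq
  rw [← tm, ← tm, ← mul_assoc (T z) (T z) (T x), mul_assoc z z x] at heq
  rw [← tm, mul_assoc z z x]
  linear_combination (1/2) * heq

theorem faithful {A : Type*} [CStarAlgebra A] [PartialOrder A] [StarOrderedRing A]
    (hsimple : ∀ I : TwoSidedIdeal A, IsClosed (I : Set A) → I = ⊥ ∨ I = ⊤)
    (f : A →ₚ[ℂ] ℂ) (hf1 : f 1 = 1) (hf : ∀ a b : A, f (a * b) = f (b * a))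
    (a : A) (ha : ∀ b, f (a * b) = 0) : a = 0 := by
  have fc : Continuous f := map_continuous f
  let I : TwoSidedIdeal A := TwoSidedIdeal.mk' {a | ∀ b, f (a * b) = 0}
    (by simp) (by intro x y hx hy b; simp [add_mul, hx b, hy b])
    (by intro x hx b; simp [hx b])
    (by intro x y hy b; rw [mul_assoc, hf, mul_assoc]; exact hy _)
    (by intro x y hx b; rw [mul_assoc]; exact hx _)
  have hI : ∀ x, x ∈ I ↔ ∀ b, f (x * b) = 0 := fun x => by
    simp only [I]; rw [TwoSidedIdeal.mem_mk']; rfl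
  have hcl : IsClosed (I : Set A) := by
    have : (I : Set A) = ⋂ b, {x | f (x * b) = 0} := by
      ext x; simp [hI]
    rw [this]
    exact isClosed_iInter fun b => isClosed_eq (by fun_prop) continuous_const
  rcases hsimple I hcl with h | h
  · have := (hI a).2 ha
    rw [h] at this
    exact (TwoSidedIdeal.mem_bot A).1 this
  · have : (1 : A) ∈ I := by rw [h]; trivial
    have := (hI 1).1 this 1
    simp [hf1] at this

end JordanAux

/-- Every surjective unital invertibility-preserving linear map from a unital complex
Banach algebra onto a simple unital C*-algebra which carries a tracial state is a
Jordan homomorphism. -/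
theorem jordan_of_invertibility_preserving_simple
    {B A : Type*} [NormedRing B] [NormedAlgebra ℂ B] [CompleteSpace B]
    [CStarAlgebra A]
    (hsimple : ∀ I : TwoSidedIdeal A, IsClosed (I : Set A) → I = ⊥ ∨ I = ⊤)
    (τ : A →ₗ[ℂ] ℂ)
    (hτ1 : τ 1 = 1)
    (hτtrace : ∀ a b : A, τ (a * b) = τ (b * a))
    (hτpos : ∀ a : A, 0 ≤ τ (star a * a))
    (T : B →ₗ[ℂ] A)
    (hTsurj : Function.Surjective T)
    (hT1 : T 1 = 1)
    (hTinv : ∀ x : B, IsUnit x → IsUnit (T x)) :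
    ∀ a : B, T (a * a) = T a * T a := by
  intro a
  let _ : PartialOrder A := CStarAlgebra.spectralOrder A
  have _ : StarOrderedRing A := CStarAlgebra.spectralOrderedRing A
  let f : A →ₚ[ℂ] ℂ := PositiveLinearMap.mk₀ τ (fun x hx => by
    obtain ⟨y, rfl⟩ := CStarAlgebra.nonneg_iff_eq_star_mul_self.1 hx
    exact hτpos y)
  rw [← sub_eq_zero]
  refine JordanAux.faithful hsimple f hτ1 hτtrace _ fun b => ?_
  obtain ⟨x, rfl⟩ := hTsurj b
  rw [sub_mul, map_sub, JordanAux.trace_mul_mul f hτ1 hτtrace T hT1 hTinv, sub_self]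
end

section
/- Let A be a unital C*-algebra with a faithful tracial state τ. Suppose that g : ℂ → A is an entire (holomorphic on all of ℂ) function whose values are all invertible elements of A. Then the function g_τ : ℂ → ℝ defined by g_τ(λ) = τ(log |g(λ)|), where |x| = (x* x)^{1/2} and log is taken via the continuous functional calculus of the positive invertible element |g(λ)|, is harmonic on ℂ (viewed as ℝ², i.e., its Laplacian vanishes). -/
open scoped ComplexOrder Topology
open Filter NormedSpace

theorem klein_aux {A : Type*} [CStarAlgebra A]
    (T : A →L[ℂ] ℂ) (h1 : T 1 = 1) (htr : ∀ a b : A, T (a * b) = T (b * a))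
    (hpos : ∀ a : A, 0 ≤ T (star a * a)) (x y : A) (hx : IsSelfAdjoint x)
    (hy : IsSelfAdjoint y) :
    (T x).re - (T y).re ≤ (T (exp (-y) * exp x)).re - 1 := by
  let +nondep : NormedAlgebra ℚ A := .restrictScalars ℚ ℂ A
  set R : A →L[ℝ] ℝ := Complex.reCLM.comp (T.restrictScalars ℝ) with hR
  have hRa : ∀ a, R a = (T a).re := fun a => rfl
  set a : ℝ → ℝ := fun t => R (exp (t • (-y)) * exp (t • x)) with ha
  have hsplit : ∀ (t : ℝ) (z : A), exp (t • z) = exp ((t/2) • z) * exp ((t/2) • z) := by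
    intro t z
    rw [← NormedSpace.exp_add_of_commute (Commute.refl _), ← add_smul]
    congr 2; ring
  have hsa : ∀ (t : ℝ) (z : A), IsSelfAdjoint z → star (exp (t • z)) = exp (t • z) := by
    intro t z hz
    exact (IsSelfAdjoint.exp (IsSelfAdjoint.smul (IsSelfAdjoint.all t) hz)).star_eq
  have hstep : ∀ t, 2 * (a (t/2) - 1) ≤ a t - 1 := by
    intro t
    have h := hpos (exp ((t/2) • x) * exp ((t/2) • (-y)) - 1)
    have hX := hsa (t/2) x hx
    have hY := hsa (t/2) (-y) hy.neg
    simp only [ha, hRa]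
    rw [hsplit t x, hsplit t (-y)]
    generalize exp ((t/2) • x) = X at *
    generalize exp ((t/2) • (-y)) = Y at *
    have e : star (X * Y - 1) * (X * Y - 1) = Y * (X * X * Y) - Y * X - X * Y + 1 := by
      simp only [star_sub, star_mul, star_one, hX, hY]; noncomm_ring
    rw [e] at h
    have e2 : T (Y * (X * X * Y)) = T (Y * Y * (X * X)) := by
      rw [htr]; rw [mul_assoc, htr]
    simp only [map_add, map_sub, h1, e2, htr X Y] at h
    have := (Complex.le_def.1 h).1
    simp at this
    linarith
  have hn : ∀ n : ℕ, 2 ^ n * (a ((1/2)^n) - 1) ≤ a 1 - 1 := by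
    intro n
    induction n with
    | zero => simp
    | succ k ih =>
      have := hstep ((1/2)^k)
      have e : ((1:ℝ)/2)^k/2 = (1/2)^(k+1) := by ring
      rw [e] at this
      refine le_trans ?_ ih
      rw [pow_succ, mul_assoc]
      gcongr
  have hd : HasDerivAt a (R x - R y) 0 := by
    have hm := (hasDerivAt_exp_smul_const (𝕂 := ℝ) (-y) (0:ℝ)).mul
      (hasDerivAt_exp_smul_const (𝕂 := ℝ) x (0:ℝ))
    have := R.hasFDerivAt.comp_hasDerivAt (0:ℝ) hm
    simp only [zero_smul, NormedSpace.exp_zero, one_mul, mul_one, map_add, map_neg] at this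
    convert! this using 1
    ring
  have ha0 : a 0 = 1 := by simp [ha, hRa, h1]
  have hl : Tendsto (fun n : ℕ => 2 ^ n * (a ((1/2)^n) - 1)) atTop (𝓝 (R x - R y)) := by
    have ht : Tendsto (fun n : ℕ => ((1:ℝ)/2)^n) atTop (𝓝[≠] 0) := by
      refine tendsto_nhdsWithin_iff.2 ⟨tendsto_pow_atTop_nhds_zero_of_lt_one (by norm_num) (by norm_num), ?_⟩
      exact Eventually.of_forall fun n => by simp
    refine ((hasDerivAt_iff_tendsto_slope.1 hd).comp ht).congr fun n => ?_
    simp [slope, ha0]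
  have := le_of_tendsto' hl hn
  simpa [ha, hRa] using this

/-- squeeze for derivatives -/
theorem hasFDerivAt_squeeze_aux {E : Type*} [NormedAddCommGroup E] [NormedSpace ℝ E]
    {l f u : E → ℝ} {L : E →L[ℝ] ℝ} {x : E} (hl : HasFDerivAt l L x) (hu : HasFDerivAt u L x)
    (hlf : ∀ y, l y ≤ f y) (hfu : ∀ y, f y ≤ u y) (e1 : l x = f x) (e2 : u x = f x) :
    HasFDerivAt f L x := by
  rw [hasFDerivAt_iff_isLittleO] at *
  refine (Asymptotics.IsBigO.of_norm_le fun y => ?_).trans_isLittleO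
    (hl.norm_left.add hu.norm_left)
  simp only [Real.norm_eq_abs, e1, e2]
  have h1 := hlf y
  have h2 := hfu y
  rw [abs_le]
  constructor
  · have := neg_abs_le (l y - f x - L (y - x))
    have := abs_nonneg (u y - f x - L (y - x))
    linarith
  · have := le_abs_self (u y - f x - L (y - x))
    have := abs_nonneg (l y - f x - L (y - x))
    linarith

theorem trace_log_le_aux {A : Type*} [CStarAlgebra A] [PartialOrder A] [StarOrderedRing A]
    (T : A →L[ℂ] ℂ) (h1 : T 1 = 1) (htr : ∀ a b : A, T (a * b) = T (b * a))
    (hpos : ∀ a : A, 0 ≤ T (star a * a)) (h k : A) (hh : IsStrictlyPositive h)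
    (hk : IsStrictlyPositive k) :
    2 * ((T (CFC.log (CFC.sqrt h))).re - (T (CFC.log (CFC.sqrt k))).re) ≤
      (T (Ring.inverse k * h)).re - 1 := by
  let +nondep : NormedAlgebra ℚ A := .restrictScalars ℚ ℂ A
  have key : ∀ h : A, IsStrictlyPositive h →
      exp ((2:ℝ) • CFC.log (CFC.sqrt h)) = h := by
    intro h hh
    rw [two_smul, NormedSpace.exp_add_of_commute (Commute.refl _),
      CFC.exp_log _ (IsStrictlyPositive.sqrt h hh), CFC.sqrt_mul_sqrt_self h hh.nonneg]
  have hsa : ∀ h : A, IsSelfAdjoint ((2:ℝ) • CFC.log (CFC.sqrt h)) := fun h =>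
    IsSelfAdjoint.smul (IsSelfAdjoint.all _) IsSelfAdjoint.log
  have hinv : exp (-((2:ℝ) • CFC.log (CFC.sqrt k))) = Ring.inverse k := by
    have := Ring.inverse_exp ((2:ℝ) • CFC.log (CFC.sqrt k))
    rw [← this, key k hk]
  have := klein_aux T h1 htr hpos _ _ (hsa h) (hsa k)
  rw [hinv, key h hh] at this
  have e : ∀ a : A, (T ((2:ℝ) • a)).re = 2 * (T a).re := by
    intro a; rw [two_smul, map_add, Complex.add_re]; ring
  rw [e, e] at this
  linarith

theorem re_star_aux {A : Type*} [CStarAlgebra A] (T : A →L[ℂ] ℂ)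
    (hpos : ∀ a : A, 0 ≤ T (star a * a)) (h1 : T 1 = 1) (a : A) :
    (T (star a)).re = (T a).re := by
  have e : star (Complex.I • a + 1) * (Complex.I • a + 1)
      = star a * a - Complex.I • star a + Complex.I • a + 1 := by
    simp only [star_add, star_smul, star_one, add_mul, mul_add, smul_mul_smul_comm, one_mul,
      mul_one, Complex.star_def, Complex.conj_I, neg_mul, Complex.I_mul_I, neg_neg, one_smul,
      neg_smul]
    abel
  have h := (Complex.le_def.1 (hpos (Complex.I • a + 1))).2
  have h' := (Complex.le_def.1 (hpos a)).2
  rw [e] at h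
  simp [h1] at h h'
  linarith

theorem hasFDerivAt_trace_log_aux {A : Type*} [CStarAlgebra A] [PartialOrder A]
    [StarOrderedRing A]
    (T : A →L[ℂ] ℂ) (h1 : T 1 = 1) (htr : ∀ a b : A, T (a * b) = T (b * a))
    (hpos : ∀ a : A, 0 ≤ T (star a * a)) (g : ℂ → A)
    (hg : Differentiable ℂ g)
    (hginv : ∀ z : ℂ, IsUnit (g z)) (z : ℂ) :
    HasFDerivAt (fun z : ℂ => (T (CFC.log (CFC.sqrt (star (g z) * g z)))).re)
      (Complex.reCLM.comp ((ContinuousLinearMap.mul ℝ ℂ) (T (Ring.inverse (g z) * deriv g z)))) z := by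
  set R : A →L[ℝ] ℝ := Complex.reCLM.comp (T.restrictScalars ℝ) with hR
  have hRa : ∀ a, R a = (T a).re := fun a => rfl
  have hsp : ∀ w, IsStrictlyPositive (star (g w) * g w) := fun w =>
    IsUnit.isStrictlyPositive ((hginv w).star.mul (hginv w)) (star_mul_self_nonneg _)
  obtain ⟨G, hG⟩ := hginv z
  set h : ℂ → A := fun w => star (g w) * g w with hh
  set d := deriv g z with hd
  set k : Aˣ := star G * G with hk
  have hkz : h z = k := by simp [hh, hk, hG]
  have hinvk : Ring.inverse (k : A) = ((k⁻¹ : Aˣ) : A) := Ring.inverse_unit k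
  have hgz : HasFDerivAt g ((ContinuousLinearMap.toSpanSingleton ℂ d).restrictScalars ℝ) z :=
    ((hg z).hasDerivAt.hasFDerivAt).restrictScalars ℝ
  obtain ⟨h', hh', hh'v⟩ : ∃ h' : ℂ →L[ℝ] A, HasFDerivAt h h' z ∧
      ∀ v : ℂ, h' v = star (G : A) * (v • d) + star (v • d) * G := by
    refine ⟨_, (hgz.star.mul' hgz), fun v => ?_⟩
    simp [← hG]
  have hval : ∀ v, R ((k⁻¹ : Aˣ) * h' v) = 2 * (T (Ring.inverse (g z) * d) * v).re := by
    intro v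
    have hk1 : ((k⁻¹ : Aˣ) : A) * star (G : A) = ((G⁻¹ : Aˣ) : A) := by
      rw [hk, mul_inv_rev, Units.val_mul, mul_assoc, ← Units.coe_star, Units.inv_mul, mul_one]
    have hk2 : (G : A) * ((k⁻¹ : Aˣ) : A) = star ((G⁻¹ : Aˣ) : A) := by
      rw [hk, mul_inv_rev, Units.val_mul, ← mul_assoc, Units.mul_inv, one_mul, ← Units.coe_star,
        star_inv]
    have e1 : T ((k⁻¹ : Aˣ) * (star (G : A) * (v • d))) = T (Ring.inverse (g z) * d) * v := by
      rw [← mul_assoc, hk1, ← hG, Ring.inverse_unit, mul_smul_comm, map_smul, smul_eq_mul, mul_comm]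
    have e2 : (T ((k⁻¹ : Aˣ) * (star (v • d) * (G : A)))).re
        = (T (Ring.inverse (g z) * d) * v).re := by
      rw [← mul_assoc, htr, ← mul_assoc, hk2, ← star_mul, re_star_aux T hpos h1, htr, ← hG,
        Ring.inverse_unit, mul_smul_comm, map_smul, smul_eq_mul, mul_comm]
    rw [hRa, hh'v, mul_add, map_add, Complex.add_re, e1, e2]
    ring
  set L := (Complex.reCLM.comp ((ContinuousLinearMap.mul ℝ ℂ) (T (Ring.inverse (g z) * d)))) with hL
  set c := (T (CFC.log (CFC.sqrt (h z)))).re with hc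
  have hu : HasFDerivAt (fun w => c + (1/2) * (R ((k⁻¹ : Aˣ) * h w) - 1)) L z := by
    have := (((R.hasFDerivAt.comp z (hh'.const_mul ((k⁻¹ : Aˣ) : A))).sub_const 1).const_mul (1/2:ℝ)).const_add c
    refine this.congr_fderiv ?_
    ext1 v
    have := hval v
    simp [hL] at this ⊢
    linarith
  have hl : HasFDerivAt (fun w => c - (1/2) * (R (Ring.inverse (h w) * k) - 1)) L z := by
    have hi : HasFDerivAt (𝕜 := ℝ) Ring.inverse _ (h z) := hkz ▸ hasFDerivAt_ringInverse (𝕜 := ℝ) k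
    have := (((R.hasFDerivAt.comp z ((hi.comp z hh').mul_const' (k : A))).sub_const 1).const_mul (1/2:ℝ)).const_sub c
    refine this.congr_fderiv ?_
    ext1 v
    have := hval v
    simp [hL] at this ⊢
    linarith
  refine hasFDerivAt_squeeze_aux hl hu (fun w => ?_) (fun w => ?_) ?_ ?_
  · have := trace_log_le_aux T h1 htr hpos (h z) (h w) (hsp z) (hsp w)
    rw [hkz] at this
    simp only [hRa, hc, hkz]
    change _ ≤ (T (CFC.log (CFC.sqrt (h w)))).re
    linarith
  · have := trace_log_le_aux T h1 htr hpos (h w) (h z) (hsp w) (hsp z)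
    rw [hkz, hinvk] at this
    simp only [hRa, hc, hkz]
    change (T (CFC.log (CFC.sqrt (h w)))).re ≤ _
    linarith
  · simp only [hkz, hinvk, hRa, Units.inv_mul, h1, hc]; simp [← hkz, hh]
  · simp only [hkz, hinvk, hRa, Units.inv_mul, h1, hc]; simp [← hkz, hh]

theorem harmonic_trace_log_abs_of_entire
    {A : Type*} [CStarAlgebra A] [PartialOrder A] [StarOrderedRing A]
    (τ : A →ₗ[ℂ] ℂ)
    (hτ1 : τ 1 = 1)
    (hτtrace : ∀ a b : A, τ (a * b) = τ (b * a))
    (hτpos : ∀ a : A, 0 ≤ τ (star a * a))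
    (hτfaithful : ∀ a : A, τ (star a * a) = 0 → a = 0)
    (g : ℂ → A)
    (hg : Differentiable ℂ g)
    (hginv : ∀ z : ℂ, IsUnit (g z)) :
    ContDiff ℝ 2 (fun z : ℂ => (τ (CFC.log (CFC.sqrt (star (g z) * g z)))).re) ∧
      ∀ z : ℂ,
        fderiv ℝ (fun w : ℂ =>
            fderiv ℝ (fun u : ℂ => (τ (CFC.log (CFC.sqrt (star (g u) * g u)))).re) w 1) z 1 +
          fderiv ℝ (fun w : ℂ =>
            fderiv ℝ (fun u : ℂ => (τ (CFC.log (CFC.sqrt (star (g u) * g u)))).re) w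
              Complex.I) z Complex.I = 0 := by
  have hcont : Continuous τ := by
    let p : A →ₚ[ℂ] ℂ := PositiveLinearMap.mk₀ τ (fun x hx => by
      obtain ⟨b, rfl⟩ := CStarAlgebra.nonneg_iff_eq_star_mul_self.1 hx
      exact hτpos b)
    exact map_continuous p
  let T : A →L[ℂ] ℂ := ⟨τ, hcont⟩
  have hder : ∀ z, HasFDerivAt (fun z : ℂ => (τ (CFC.log (CFC.sqrt (star (g z) * g z)))).re) _ z :=
    hasFDerivAt_trace_log_aux T hτ1 hτtrace hτpos g hg hginv
  set φ : ℂ → ℂ := fun z => T (Ring.inverse (g z) * deriv g z) with hφ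
  have hφd : Differentiable ℂ φ := by
    intro z
    have h1 : DifferentiableAt ℂ (fun z => Ring.inverse (g z)) z :=
      (differentiableAt_inverse (hginv z)).comp z (hg z)
    have h2 : DifferentiableAt ℂ (deriv g) z :=
      (hg.differentiableOn.deriv isOpen_univ).differentiableAt Filter.univ_mem
    exact T.differentiableAt.comp z (h1.mul h2)
  have hfd : fderiv ℝ (fun z : ℂ => (τ (CFC.log (CFC.sqrt (star (g z) * g z)))).re) =
      fun z => Complex.reCLM.comp (ContinuousLinearMap.mul ℝ ℂ (φ z)) :=
    funext fun z => (hder z).fderiv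
  constructor
  · rw [show (2 : WithTop ℕ∞) = ((1:ℕ) : WithTop ℕ∞) + 1 by norm_num,
      contDiff_succ_iff_hasFDerivAt]
    refine ⟨_, ?_, hder⟩
    have h3 : ContDiff ℝ (1:ℕ) φ := (hφd.contDiff (n := (1:ℕ))).restrict_scalars ℝ
    exact contDiff_const.clm_comp ((ContinuousLinearMap.mul ℝ ℂ).contDiff.comp h3)
  · intro z
    rw [hfd]
    have hz : HasFDerivAt φ _ z := ((hφd z).hasDerivAt.hasFDerivAt).restrictScalars ℝ
    have hv : ∀ v : ℂ, fderiv ℝ (fun w => (Complex.reCLM.comp (ContinuousLinearMap.mul ℝ ℂ (φ w))) v) z v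
        = (v * deriv φ z * v).re := by
      intro v
      have := (Complex.reCLM.hasFDerivAt.comp z (hz.mul_const v)).fderiv
      refine (DFunLike.congr_fun this v).trans ?_
      simp
      ring
    rw [hv, hv]
    simp
end
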